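/- arXiv:math/0311469 — 4 statements merged into one kernel-verified Lean document; each statement's English description precedes it below -/
import Mathlib

section
/- The set G := { f ∈ C(I^l, ℝ) : there exist a continuous g : I^l → ℝ with g ≥ 0 and g(0,…,0) = 0 and a continuous γ : I^{l−1} → ℝ such that f(x₁,…,x_l) = g(x₁,…,x_l) + γ(x₁,…,x_{l−1}) − γ(x₂,…,x_l) for all (x₁,…,x_l) ∈ I^l } is closed in the space C(I^l, ℝ) of continuous real-valued functions on I^l equipped with the supremum norm. -/
noncomputable section

section Windows

variable {X : Type*}

/-- The block of `n` consecutive terms of the sequence `x` starting at index `i`. -/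
def window (n : ℕ) (x : ℕ → X) (i : ℕ) : Fin n → X := fun j => x (i + j)

/-- The sequence that starts with the word `y` and continues with `z`. -/
def prependWord {m : ℕ} (y : Fin m → X) (z : ℕ → X) : ℕ → X :=
  fun i => if h : i < m then y ⟨i, h⟩ else z (i - m)

theorem prependWord_of_lt {m : ℕ} (y : Fin m → X) (z : ℕ → X) {i : ℕ} (h : i < m) :
    prependWord y z i = y ⟨i, h⟩ := dif_pos h

theorem prependWord_of_le {m : ℕ} (y : Fin m → X) (z : ℕ → X) {i : ℕ} (h : m ≤ i) :
    prependWord y z i = z (i - m) := dif_neg (by omega)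

theorem window_prependWord_add {m : ℕ} (n : ℕ) (y : Fin m → X) (z : ℕ → X) (i : ℕ) :
    window n (prependWord y z) (m + i) = window n z i := by
  funext j
  simp only [window]
  rw [prependWord_of_le _ _ (by omega)]
  congr 1
  omega

theorem dist_window_prependWord_le [PseudoMetricSpace X] {m : ℕ} (n : ℕ) (y y' : Fin m → X)
    (z : ℕ → X) (i : ℕ) :
    dist (window n (prependWord y z) i) (window n (prependWord y' z) i) ≤ dist y y' := by
  refine (dist_pi_le_iff dist_nonneg).2 fun j => ?_
  simp only [window]
  by_cases h : i + j < m
  · rw [prependWord_of_lt _ _ h, prependWord_of_lt _ _ h]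
    exact dist_le_pi_dist y y' _
  · rw [prependWord_of_le _ _ (by omega), prependWord_of_le _ _ (by omega), dist_self]
    exact dist_nonneg

/-- The sum of `f` over the first `N` windows of the sequence `x`. -/
def windowSum {n : ℕ} (f : (Fin n → X) → ℝ) (N : ℕ) (x : ℕ → X) : ℝ :=
  ∑ i ∈ Finset.range N, f (window n x i)

theorem windowSum_prependWord {m n : ℕ} (f : (Fin n → X) → ℝ) (N : ℕ) (y : Fin m → X)
    (z : ℕ → X) :
    windowSum f (N + m) (prependWord y z) =
      windowSum f m (prependWord y z) + windowSum f N z := by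
  simp only [windowSum]
  rw [add_comm N m, Finset.sum_range_add]
  simp only [window_prependWord_add]

/-- Sequences that take the value `o` from some recorded index on. -/
abbrev EventuallyConst (o : X) : Type _ := {p : ℕ × (ℕ → X) // ∀ i, p.1 ≤ i → p.2 i = o}

/-- The infimum of the sums of `f` along sequences that lead from the word `y` to the constant
sequence `o`. -/
def potential {m : ℕ} (o : X) (f : (Fin (m + 1) → X) → ℝ) (y : Fin m → X) : ℝ :=
  ⨅ p : EventuallyConst o, windowSum f (p.1.1 + m) (prependWord y p.1.2)

/-- All sums of `f` along sequences that start and end with the letter `o` repeated are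
nonnegative. -/
def LoopNonneg {m : ℕ} (o : X) (f : (Fin (m + 1) → X) → ℝ) : Prop :=
  ∀ (N : ℕ) (x : ℕ → X), (∀ i < m, x i = o) → (∀ i, N ≤ i → x i = o) → 0 ≤ windowSum f N x

instance (o : X) : Nonempty (EventuallyConst o) := ⟨⟨(0, fun _ => o), fun _ _ => rfl⟩⟩

theorem loopNonneg_of_coboundary_le {m : ℕ} {o : X} {f : (Fin (m + 1) → X) → ℝ}
    (γ : (Fin m → X) → ℝ)
    (h : ∀ x : Fin (m + 1) → X, γ (fun j => x j.castSucc) - γ (fun j => x j.succ) ≤ f x) :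
    LoopNonneg o f := by
  intro N x hx hN
  have key : γ (window m x 0) - γ (window m x N) ≤ windowSum f N x := by
    rw [windowSum, ← Finset.sum_range_sub' (fun i => γ (window m x i))]
    refine Finset.sum_le_sum fun i _ => ?_
    have hshift : window m x (i + 1) = fun j => window (m + 1) x i j.succ := by
      funext j
      simp only [window, Fin.val_succ]
      congr 1
      omega
    rw [hshift]
    exact h (window (m + 1) x i)
  have heq : window m x 0 = window m x N := by
    funext j
    simp only [window]
    rw [hx _ (by omega), hN _ (by omega)]
  rw [heq, sub_self] at key
  exact key

variable {m : ℕ} {o : X} {f : (Fin (m + 1) → X) → ℝ}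

theorem LoopNonneg.neg_le_windowSum (hf : LoopNonneg o f) {C : ℝ} (hC : ∀ x, f x ≤ C)
    (y : Fin m → X) (p : EventuallyConst o) :
    -(m * C) ≤ windowSum f (p.1.1 + m) (prependWord y p.1.2) := by
  have h := hf (p.1.1 + m + m) (prependWord (fun _ : Fin m => o) (prependWord y p.1.2))
    (fun i hi => prependWord_of_lt _ _ hi) (fun i hi => by
      rw [prependWord_of_le _ _ (by omega), prependWord_of_le _ _ (by omega)]
      exact p.2 _ (by omega))
  rw [windowSum_prependWord] at h
  have hle : windowSum f m (prependWord (fun _ : Fin m => o) (prependWord y p.1.2)) ≤ m * C := by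
    simpa [windowSum] using Finset.sum_le_card_nsmul (Finset.range m) _ C
      fun i _ => hC (window (m + 1) (prependWord (fun _ : Fin m => o) (prependWord y p.1.2)) i)
  linarith

theorem LoopNonneg.bddBelow (hf : LoopNonneg o f) {C : ℝ} (hC : ∀ x, f x ≤ C)
    (y : Fin m → X) :
    BddBelow (Set.range fun p : EventuallyConst o =>
      windowSum f (p.1.1 + m) (prependWord y p.1.2)) :=
  ⟨-(m * C), by rintro _ ⟨p, rfl⟩; exact hf.neg_le_windowSum hC y p⟩

theorem LoopNonneg.potential_le (hf : LoopNonneg o f) {C : ℝ} (hC : ∀ x, f x ≤ C)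
    (x : Fin (m + 1) → X) :
    potential o f (fun j => x j.castSucc) ≤ f x + potential o f (fun j => x j.succ) := by
  rw [← sub_le_iff_le_add']
  refine le_ciInf fun p => ?_
  rw [sub_le_iff_le_add']
  have hq : ∀ i, p.1.1 + 1 ≤ i → prependWord (fun _ : Fin 1 => x (Fin.last m)) p.1.2 i = o :=
    fun i hi => by
      rw [prependWord_of_le _ _ (by omega)]
      exact p.2 _ (by omega)
  refine (ciInf_le (hf.bddBelow hC _) ⟨(p.1.1 + 1, prependWord (fun _ : Fin 1 => x (Fin.last m)) p.1.2), hq⟩).trans_eq ?_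
  have hseq : prependWord (fun j : Fin m => x j.castSucc)
      (prependWord (fun _ : Fin 1 => x (Fin.last m)) p.1.2) =
      prependWord (fun _ : Fin 1 => x 0) (prependWord (fun j : Fin m => x j.succ) p.1.2) := by
    funext i
    rcases lt_trichotomy i m with h | rfl | h
    · rw [prependWord_of_lt _ _ h]
      rcases i with _ | i
      · rw [prependWord_of_lt _ _ one_pos]
        rfl
      · rw [prependWord_of_le _ _ (by omega), prependWord_of_lt _ _ (by omega)]
        rfl
    · rw [prependWord_of_le _ _ le_rfl, prependWord_of_lt _ _ (by omega)]
      rcases i with _ | i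
      · rw [prependWord_of_lt _ _ one_pos]
        rfl
      · rw [prependWord_of_le _ _ (by omega), prependWord_of_lt _ _ (by omega)]
        rfl
    · rw [prependWord_of_le _ _ h.le,
        prependWord_of_le (fun _ : Fin 1 => x (Fin.last m)) _ (by omega),
        prependWord_of_le (fun _ : Fin 1 => x 0) _ (by omega), prependWord_of_le _ _ (by omega)]
      rw [Nat.sub_right_comm]
  have hwin : window (m + 1)
      (prependWord (fun _ : Fin 1 => x 0) (prependWord (fun j : Fin m => x j.succ) p.1.2)) 0 =
      x := by
    funext j
    simp only [window, zero_add]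
    refine Fin.cases ?_ (fun j => ?_) j
    · exact prependWord_of_lt _ _ one_pos
    · rw [prependWord_of_le _ _ (by simp), prependWord_of_lt _ _ (by simp)]
      rfl
  dsimp only
  rw [hseq, add_right_comm, windowSum_prependWord]
  simp [windowSum, hwin]

theorem LoopNonneg.continuous_potential [PseudoMetricSpace X] (hf : LoopNonneg o f) {C : ℝ}
    (hC : ∀ x, f x ≤ C) (hu : UniformContinuous f) : Continuous (potential o f) := by
  refine UniformContinuous.continuous (Metric.uniformContinuous_iff.2 fun ε hε => ?_)
  obtain ⟨δ, hδ, h⟩ := Metric.uniformContinuous_iff.1 hu (ε / (m + 1)) (by positivity)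
  have hm : m * (ε / (m + 1)) < ε := by
    rw [mul_div_assoc', div_lt_iff₀ (by positivity)]
    linarith
  have hle : ∀ y y' : Fin m → X, dist y y' < δ →
      potential o f y ≤ potential o f y' + m * (ε / (m + 1)) := by
    intro y y' hy
    rw [← sub_le_iff_le_add]
    refine le_ciInf fun p => ?_
    rw [sub_le_iff_le_add]
    refine (ciInf_le (hf.bddBelow hC y) p).trans ?_
    rw [windowSum_prependWord, windowSum_prependWord]
    have hsum : windowSum f m (prependWord y p.1.2) - windowSum f m (prependWord y' p.1.2) ≤
        m * (ε / (m + 1)) := by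
      rw [windowSum, windowSum, ← Finset.sum_sub_distrib]
      refine (Finset.sum_le_card_nsmul _ _ (ε / (m + 1)) fun i _ => ?_).trans_eq (by simp)
      refine (le_abs_self _).trans ?_
      rw [← Real.dist_eq]
      exact (h ((dist_window_prependWord_le _ _ _ _ _).trans_lt hy)).le
    linarith
  refine ⟨δ, hδ, fun y y' hy => ?_⟩
  rw [Real.dist_eq, abs_lt]
  have h₁ := hle y y' hy
  have h₂ := hle y' y (by rwa [dist_comm])
  constructor <;> linarith

end Windows

theorem exists_coboundary_iff {X : Type*} [PseudoMetricSpace X] [CompactSpace X] {m : ℕ} (o : X)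
    (f : C(Fin (m + 1) → X, ℝ)) :
    (∃ g : C(Fin (m + 1) → X, ℝ), ∃ γ : C(Fin m → X, ℝ), (∀ x, 0 ≤ g x) ∧ g (fun _ => o) = 0 ∧
      ∀ x, f x = g x + γ (fun j => x j.castSucc) - γ (fun j => x j.succ)) ↔
    f (fun _ => o) = 0 ∧ LoopNonneg o f := by
  constructor
  · rintro ⟨g, γ, hg, hg0, h⟩
    refine ⟨by simp [h, hg0], loopNonneg_of_coboundary_le γ fun x => ?_⟩
    linarith [h x, hg x]
  · rintro ⟨h0, hf⟩
    have hC : ∀ x, f x ≤ ‖f‖ := fun x => (le_abs_self _).trans (f.norm_coe_le_norm x)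
    have hγ := hf.continuous_potential hC (CompactSpace.uniformContinuous_of_continuous f.2)
    refine ⟨⟨fun x => f x - potential o f (fun j => x j.castSucc) +
      potential o f (fun j => x j.succ), ?_⟩, ⟨potential o f, hγ⟩, fun x => ?_, ?_, fun x => ?_⟩
    · exact (f.continuous.sub (hγ.comp (by fun_prop))).add (hγ.comp (by fun_prop))
    · have := hf.potential_le hC x
      simp only [ContinuousMap.coe_mk]
      linarith
    · simp [h0]
    · simp only [ContinuousMap.coe_mk]
      ring

theorem isClosed_setOf_exists_coboundary {X : Type*} [PseudoMetricSpace X] [CompactSpace X]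
    {m : ℕ} (o : X) :
    IsClosed {f : C(Fin (m + 1) → X, ℝ) |
      ∃ g : C(Fin (m + 1) → X, ℝ), ∃ γ : C(Fin m → X, ℝ), (∀ x, 0 ≤ g x) ∧ g (fun _ => o) = 0 ∧
        ∀ x, f x = g x + γ (fun j => x j.castSucc) - γ (fun j => x j.succ)} := by
  simp only [exists_coboundary_iff, LoopNonneg, windowSum, Set.ofPred_and, Set.ofPred_forall]
  refine (isClosed_eq (by fun_prop) continuous_const).inter ?_
  exact isClosed_iInter fun N => isClosed_iInter fun x => isClosed_iInter fun _ =>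
    isClosed_iInter fun _ => isClosed_le continuous_const (by fun_prop)

/-- The set of functions of the form `g(x₁,…,x_l) + γ(x₁,…,x_{l-1}) - γ(x₂,…,x_l)`
with `g ≥ 0` continuous, `g(0,…,0) = 0`, and `γ` continuous, is closed in
`C(Iˡ, ℝ)` with the uniform norm. -/
theorem stmt_7
    (l : ℕ) (hl : 2 ≤ l) (α β : ℝ) (hα : α ≤ 0) (hβ : 0 ≤ β) :
    IsClosed {f : C((Fin l → Set.Icc α β), ℝ) |
      ∃ g : C((Fin l → Set.Icc α β), ℝ), ∃ γ : C((Fin (l - 1) → Set.Icc α β), ℝ),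
        (∀ x, 0 ≤ g x) ∧
        g (fun _ => ⟨0, Set.mem_Icc.mpr ⟨hα, hβ⟩⟩) = 0 ∧
        ∀ x : Fin l → Set.Icc α β,
          f x = g x
            + γ (fun j : Fin (l - 1) => x ⟨(j : ℕ), by have := j.2; omega⟩)
            - γ (fun j : Fin (l - 1) => x ⟨(j : ℕ) + 1, by have := j.2; omega⟩)} := by
  obtain ⟨m, rfl⟩ : ∃ m, l = m + 1 := ⟨l - 1, by omega⟩
  exact isClosed_setOf_exists_coboundary (m := m) (⟨0, Set.mem_Icc.mpr ⟨hα, hβ⟩⟩ : Set.Icc α β)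

end
end

section
/- For every integer l ≥ 1 and every z ∈ ℝ: z·U_l(z) − (1/π)·∫_{−2}^{2} ((U_l(x) − U_l(z))/(x − z))·√(4−x²) dx = T_l(z), where (U_l(x) − U_l(z))/(x − z) denotes the polynomial divided difference in the two variables x, z (so the identity makes sense for all z, including z ∈ [−2,2]). -/
open Polynomial intervalIntegral
open scoped Real

noncomputable section

/-- Chebyshev polynomials of the first kind normalized to `[-2,2]`:
`T_l(2cos θ) = 2cos(lθ)`. -/
def T : ℕ → Polynomial ℝ
  | 0 => Polynomial.C 2
  | 1 => Polynomial.X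
  | (n + 2) => Polynomial.X * T (n + 1) - T n

/-- Chebyshev polynomials of the second kind normalized to `[-2,2]`:
`U_l(2cos θ) = sin(lθ)/sin θ`. -/
def U : ℕ → Polynomial ℝ
  | 0 => 0
  | 1 => 1
  | (n + 2) => Polynomial.X * U (n + 1) - U n

lemma U_eval_two_mul_cos_mul_sin (θ : ℝ) :
    ∀ m : ℕ, (U m).eval (2 * Real.cos θ) * Real.sin θ = Real.sin (m * θ)
  | 0 => by simp [U]
  | 1 => by simp [U]
  | (m + 2) => by
    have h₁ := U_eval_two_mul_cos_mul_sin θ (m + 1)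
    have h₀ := U_eval_two_mul_cos_mul_sin θ m
    have e₂ : ((m + 2 : ℕ) : ℝ) * θ = ((m + 1 : ℕ) : ℝ) * θ + θ := by push_cast; ring
    have e₀ : (m : ℝ) * θ = ((m + 1 : ℕ) : ℝ) * θ - θ := by push_cast; ring
    rw [e₀, Real.sin_sub] at h₀
    rw [e₂, Real.sin_add]
    simp only [U, eval_sub, eval_mul, eval_X]
    linear_combination 2 * Real.cos θ * h₁ - h₀

lemma integral_cos_nat_mul (k : ℕ) (hk : k ≠ 0) : ∫ θ in (0 : ℝ)..π, Real.cos (k * θ) = 0 := by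
  rw [intervalIntegral.integral_comp_mul_left (fun x => Real.cos x) (Nat.cast_ne_zero.mpr hk)]
  simp [Real.sin_nat_mul_pi]

lemma integral_sin_nat_mul_sin (m : ℕ) :
    ∫ θ in (0 : ℝ)..π, Real.sin ((m + 1 : ℕ) * θ) * Real.sin θ = if m = 0 then π / 2 else 0 := by
  have h : ∀ θ : ℝ, Real.sin ((m + 1 : ℕ) * θ) * Real.sin θ
      = (1 / 2) * (Real.cos (m * θ) - Real.cos ((m + 2 : ℕ) * θ)) := by
    intro θ
    have e₂ : ((m + 2 : ℕ) : ℝ) * θ = ((m + 1 : ℕ) : ℝ) * θ + θ := by push_cast; ring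
    have e₀ : (m : ℝ) * θ = ((m + 1 : ℕ) : ℝ) * θ - θ := by push_cast; ring
    rw [e₀, e₂, Real.cos_sub, Real.cos_add]
    ring
  simp_rw [h]
  rw [intervalIntegral.integral_const_mul, intervalIntegral.integral_sub
    (Continuous.intervalIntegrable (by fun_prop) _ _)
    (Continuous.intervalIntegrable (by fun_prop) _ _), integral_cos_nat_mul (m + 2) (by omega)]
  split_ifs with hm
  · subst hm
    simp
    ring
  · rw [integral_cos_nat_mul m hm]
    simp

/-- `U (m + 1)` is orthogonal to constants for the semicircle weight unless `m = 0`. -/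
lemma integral_U_mul_sqrt (m : ℕ) :
    ∫ x in (-2 : ℝ)..2, (U (m + 1)).eval x * Real.sqrt (4 - x ^ 2)
      = if m = 0 then 2 * π else 0 := by
  have hsub := intervalIntegral.integral_comp_mul_deriv (a := 0) (b := π)
    (f := fun θ => 2 * Real.cos θ) (f' := fun θ => 2 * (-Real.sin θ))
    (g := fun x => (U (m + 1)).eval x * Real.sqrt (4 - x ^ 2))
    (fun θ _ => (Real.hasDerivAt_cos θ).const_mul 2) (by fun_prop) (by fun_prop)
  have hcongr : ∫ θ in (0 : ℝ)..π,
      ((fun x => (U (m + 1)).eval x * Real.sqrt (4 - x ^ 2)) ∘ fun θ => 2 * Real.cos θ) θ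
        * (2 * (-Real.sin θ))
      = ∫ θ in (0 : ℝ)..π, (-4) * (Real.sin ((m + 1 : ℕ) * θ) * Real.sin θ) := by
    refine intervalIntegral.integral_congr fun θ hθ => ?_
    rw [Set.uIcc_of_le Real.pi_pos.le] at hθ
    have hs : Real.sqrt (4 - (2 * Real.cos θ) ^ 2) = 2 * Real.sin θ := by
      rw [show 4 - (2 * Real.cos θ) ^ 2 = (2 * Real.sin θ) ^ 2 by
        linear_combination (-4) * Real.sin_sq_add_cos_sq θ]
      exact Real.sqrt_sq (mul_nonneg zero_le_two (Real.sin_nonneg_of_mem_Icc hθ))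
    simp only [Function.comp_apply, hs, ← U_eval_two_mul_cos_mul_sin θ (m + 1)]
    ring
  rw [hcongr, intervalIntegral.integral_const_mul, integral_sin_nat_mul_sin] at hsub
  simp only [Real.cos_zero, Real.cos_pi, mul_one, mul_neg] at hsub
  rw [intervalIntegral.integral_symm, ← hsub]
  split_ifs <;> ring

/-- The divided difference `(U_l(x) - U_l(z)) / (x - z)` as a polynomial in `x`. -/
def dividedDiffU (z : ℝ) : ℕ → Polynomial ℝ
  | 0 => 0
  | 1 => 0
  | (n + 2) => U (n + 1) + Polynomial.C z * dividedDiffU z (n + 1) - dividedDiffU z n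

lemma dividedDiffU_eval_mul (z x : ℝ) :
    ∀ n : ℕ, (dividedDiffU z n).eval x * (x - z) = (U n).eval x - (U n).eval z
  | 0 => by simp [U, dividedDiffU]
  | 1 => by simp [U, dividedDiffU]
  | (n + 2) => by
    have h₁ := dividedDiffU_eval_mul z x (n + 1)
    have h₀ := dividedDiffU_eval_mul z x n
    simp only [U, dividedDiffU, eval_sub, eval_add, eval_mul, eval_X, eval_C]
    linear_combination z * h₁ - h₀

lemma integral_dividedDiffU_mul_sqrt (z : ℝ) :
    ∀ n : ℕ, ∫ x in (-2 : ℝ)..2, (dividedDiffU z (n + 1)).eval x * Real.sqrt (4 - x ^ 2)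
      = 2 * π * (U n).eval z
  | 0 => by simp [U, dividedDiffU]
  | (n + 1) => by
    have h₁ := integral_dividedDiffU_mul_sqrt z n
    have hI : ∀ p : Polynomial ℝ, IntervalIntegrable
        (fun x => p.eval x * Real.sqrt (4 - x ^ 2)) MeasureTheory.volume (-2) 2 :=
      fun p => Continuous.intervalIntegrable (by fun_prop) _ _
    have hsplit : ∀ x : ℝ, (dividedDiffU z (n + 2)).eval x * Real.sqrt (4 - x ^ 2)
        = (U (n + 1)).eval x * Real.sqrt (4 - x ^ 2)
          + z * ((dividedDiffU z (n + 1)).eval x * Real.sqrt (4 - x ^ 2))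
          - (dividedDiffU z n).eval x * Real.sqrt (4 - x ^ 2) := by
      intro x
      simp only [dividedDiffU, eval_sub, eval_add, eval_mul, eval_C]
      ring
    simp_rw [hsplit]
    rw [intervalIntegral.integral_sub ((hI _).add ((hI _).const_mul z)) (hI _),
      intervalIntegral.integral_add (hI _) ((hI _).const_mul z),
      intervalIntegral.integral_const_mul, h₁, integral_U_mul_sqrt]
    match n with
    | 0 => simp [U, dividedDiffU]
    | (k + 1) =>
      rw [integral_dividedDiffU_mul_sqrt z k]
      simp [U]
      ring

lemma T_succ_eq_X_mul_U_sub : ∀ n : ℕ, T (n + 1) = Polynomial.X * U (n + 1) - Polynomial.C 2 * U n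
  | 0 => by simp [T, U]
  | 1 => by simp [T, U]
  | (n + 2) => by
    have h₁ := T_succ_eq_X_mul_U_sub (n + 1)
    have h₀ := T_succ_eq_X_mul_U_sub n
    rw [T, h₁, h₀, U.eq_3 (n + 1)]
    linear_combination (Polynomial.C 2 : Polynomial ℝ) * U.eq_3 n

/-- `z U_l(z) - (1/π) ∫_{-2}^2 ((U_l(x) - U_l(z))/(x - z)) √(4-x²) dx = T_l(z)`. -/
theorem stmt_8 (l : ℕ) (hl : 1 ≤ l) (z : ℝ) :
    z * (U l).eval z
      - (1 / π) * ∫ x in (-2 : ℝ)..2,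
          (((U l).eval x - (U l).eval z) / (x - z)) * Real.sqrt (4 - x ^ 2)
    = (T l).eval z := by
  obtain ⟨n, rfl⟩ := Nat.exists_eq_add_of_le' hl
  have hae : ∫ x in (-2 : ℝ)..2,
      (((U (n + 1)).eval x - (U (n + 1)).eval z) / (x - z)) * Real.sqrt (4 - x ^ 2)
      = ∫ x in (-2 : ℝ)..2, (dividedDiffU z (n + 1)).eval x * Real.sqrt (4 - x ^ 2) := by
    refine intervalIntegral.integral_congr_ae ?_
    filter_upwards [MeasureTheory.Measure.ae_ne MeasureTheory.volume z] with x hx _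
    rw [← dividedDiffU_eval_mul, mul_div_cancel_right₀ _ (sub_ne_zero.mpr hx)]
  rw [hae, integral_dividedDiffU_mul_sqrt, T_succ_eq_X_mul_U_sub]
  simp only [eval_sub, eval_mul, eval_X, eval_C]
  field_simp

end
end

section
/- For every finitely supported sequence c : {1, 2, 3, …} → ℝ one has Σ_{k≥1} Σ_{l≥1} ( a_{k+l}(J) − a_{|k−l|}(J) )·c_k·c_l ≥ 0; that is, the infinite matrix ( a_{k+l}(J) − a_{|k−l|}(J) )_{k≥1, l≥1} is positive semidefinite. -/
open Polynomial
open scoped ENNReal RealInnerProductSpace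

noncomputable section

/-- The real Hilbert space `ℓ²(ℤ)`. -/
abbrev HZ : Type := lp (fun _ : ℤ => ℝ) 2

/-- The standard orthonormal basis of `ℓ²(ℤ)`. -/
def ez (k : ℤ) : HZ := lp.single 2 k 1

/-- Shrinking `v` towards the origin decreases `‖1 - v‖` by at most the factor `(1 + r) / 2`. -/
lemma half_one_add_mul_norm_one_sub_le {r : ℝ} (hr0 : 0 ≤ r) (hr1 : r ≤ 1) {v : ℂ} (hv : ‖v‖ ≤ 1) :
    (1 + r) / 2 * ‖1 - v‖ ≤ ‖1 - r * v‖ := by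
  refine (sq_le_sq₀ (by positivity) (norm_nonneg _)).1 ?_
  have hv' : v.re * v.re + v.im * v.im ≤ 1 := by
    have h := Complex.sq_norm v
    rw [Complex.normSq_apply] at h
    nlinarith [norm_nonneg v]
  rw [mul_pow, Complex.sq_norm, Complex.sq_norm, Complex.normSq_apply, Complex.normSq_apply]
  simp only [Complex.sub_re, Complex.one_re, Complex.sub_im, Complex.one_im, Complex.mul_re,
    Complex.mul_im, Complex.ofReal_re, Complex.ofReal_im]
  have hre : v.re ^ 2 ≤ 1 := by nlinarith [sq_nonneg v.im]
  nlinarith [mul_nonneg (sub_nonneg.2 hv')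
      (mul_nonneg (sub_nonneg.2 hr1) (by linarith : 0 ≤ 1 + 3 * r)),
    mul_nonneg (sq_nonneg (1 - r)) (by nlinarith : 0 ≤ 1 + v.re), mul_nonneg hr0 (sub_nonneg.2 hv')]

lemma log_norm_one_sub_le_taylor {w : ℂ} (hw : ‖w‖ < 1) (L : ℕ) :
    Real.log ‖1 - w‖ ≤ ‖w‖ ^ (L + 1) * (1 - ‖w‖)⁻¹ - ∑ n ∈ Finset.Icc 1 L, (w ^ n).re / n := by
  have h := Complex.norm_log_sub_logTaylor_le L (z := -w) (by simpa using hw)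
  rw [norm_neg] at h
  have h2 := (Complex.re_le_norm _).trans h
  rw [Complex.sub_re, Complex.log_re] at h2
  have h3 : (Complex.logTaylor (L + 1) (-w)).re = - ∑ n ∈ Finset.Icc 1 L, (w ^ n).re / n := by
    rw [Complex.logTaylor, Finset.sum_range_succ', Complex.add_re, Complex.re_sum,
      ← Finset.sum_neg_distrib, Finset.range_eq_Ico, Finset.sum_Ico_add' (fun n : ℕ =>
        ((-1 : ℂ) ^ (n + 1) * (-w) ^ n / (n : ℂ)).re) 0 L 1]
    simp only [zero_add, CharP.cast_eq_zero, div_zero, Complex.zero_re, add_zero]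
    refine Finset.sum_congr (by ext; simp) fun n _ => ?_
    have : (-1 : ℂ) ^ (n + 1) * (-w) ^ n / (n : ℂ) = ((-1 / (n : ℝ) : ℝ) : ℂ) * w ^ n := by
      rw [neg_pow w n, pow_succ]
      have : ((-1 : ℂ) ^ n) * (-1) ^ n = 1 := by rw [← mul_pow]; simp
      push_cast
      linear_combination (-(w ^ n) / (n : ℂ)) * this
    rw [this, Complex.re_ofReal_mul]
    ring
  have h4 : ‖w‖ ^ (L + 1) * (1 - ‖w‖)⁻¹ / (L + 1) ≤ ‖w‖ ^ (L + 1) * (1 - ‖w‖)⁻¹ := by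
    refine div_le_self (mul_nonneg (by positivity) (inv_nonneg.2 (by linarith))) ?_
    have : (0 : ℝ) ≤ L := by positivity
    linarith
  rw [h3, ← sub_eq_add_neg] at h2
  linarith

/-- On the closed unit disc, `log ‖1 - v‖` is bounded above, up to `ε`, by a harmonic polynomial
whose first coefficients are close to those of its Taylor series. -/
lemma exists_log_norm_one_sub_majorant (D : ℕ) {ε : ℝ} (hε : 0 < ε) :
    ∃ (L : ℕ) (b : ℕ → ℝ), D ≤ L ∧ (∀ n ∈ Finset.Icc 1 D, |b n - 1 / n| ≤ ε) ∧
      ∀ v : ℂ, ‖v‖ ≤ 1 → v ≠ 1 →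
        Real.log ‖1 - v‖ ≤ ε - ∑ n ∈ Finset.Icc 1 L, b n * (v ^ n).re := by
  obtain ⟨r, hlog, hb, hr0, hr1⟩ : ∃ r : ℝ, Real.log (2 / (1 + r)) < ε / 2 ∧
      (∀ n ∈ Finset.Icc 1 D, |r ^ n / n - 1 / n| < ε) ∧ 0 < r ∧ r < 1 := by
    have h1 : ∀ᶠ r : ℝ in nhds 1, Real.log (2 / (1 + r)) < ε / 2 := by
      have : ContinuousAt (fun r : ℝ => Real.log (2 / (1 + r))) 1 := by
        refine ContinuousAt.log (continuousAt_const.div (by fun_prop) (by norm_num)) (by norm_num)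
      refine this.eventually_lt continuousAt_const ?_
      norm_num
      exact hε
    have h2 : ∀ᶠ r : ℝ in nhds 1, ∀ n ∈ Finset.Icc 1 D, |r ^ n / n - 1 / n| < ε := by
      refine (Finset.eventually_all _).2 fun n _ => ?_
      have : ContinuousAt (fun r : ℝ => |r ^ n / n - 1 / n|) 1 := by fun_prop
      refine this.eventually_lt continuousAt_const ?_
      simpa using hε
    have h3 : ∀ᶠ r : ℝ in nhds 1, 0 < r := lt_mem_nhds one_pos
    have h := ((h1.and (h2.and h3)).filter_mono nhdsWithin_le_nhds).and
      (self_mem_nhdsWithin : Set.Iio (1 : ℝ) ∈ nhdsWithin 1 (Set.Iio 1))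
    obtain ⟨r, ⟨h1, h2, h3⟩, h4⟩ := h.exists
    exact ⟨r, h1, h2, h3, h4⟩
  obtain ⟨L₀, hL₀⟩ := exists_pow_lt_of_lt_one (mul_pos (half_pos hε) (sub_pos.2 hr1)) hr1
  refine ⟨max D L₀, fun n => r ^ n / n, le_max_left _ _, fun n hn => (hb n hn).le,
    fun v hv hv1 => ?_⟩
  have hpos : 0 < ‖1 - v‖ := norm_pos_iff.2 (sub_ne_zero.2 hv1.symm)
  have hw : ‖(r : ℂ) * v‖ ≤ r := by
    rw [norm_mul, Complex.norm_real, Real.norm_of_nonneg hr0.le]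
    exact mul_le_of_le_one_right hr0.le hv
  have h1 := Real.log_le_log (by positivity) (half_one_add_mul_norm_one_sub_le hr0.le hr1.le hv)
  rw [Real.log_mul (by positivity) hpos.ne', ← inv_div, Real.log_inv] at h1
  have h2 := log_norm_one_sub_le_taylor (hw.trans_lt hr1) (max D L₀)
  have h3 : ‖(r : ℂ) * v‖ ^ (max D L₀ + 1) * (1 - ‖(r : ℂ) * v‖)⁻¹ ≤ ε / 2 := by
    have h4 : ‖(r : ℂ) * v‖ ^ (max D L₀ + 1) ≤ r ^ L₀ :=
      (pow_le_pow_left₀ (norm_nonneg _) hw _).trans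
        (pow_le_pow_of_le_one hr0.le hr1.le ((le_max_right _ _).trans (Nat.le_succ _)))
    rw [← div_eq_mul_inv, div_le_iff₀ (by linarith)]
    nlinarith
  have h5 : ∑ n ∈ Finset.Icc 1 (max D L₀), (((r : ℂ) * v) ^ n).re / n =
      ∑ n ∈ Finset.Icc 1 (max D L₀), r ^ n / n * (v ^ n).re := by
    refine Finset.sum_congr rfl fun n _ => ?_
    rw [mul_pow, ← Complex.ofReal_pow, Complex.re_ofReal_mul]
    ring
  rw [h5] at h2
  linarith

lemma sum_cos_mul_two_pi_div {M k : ℕ} (hk : 0 < k) (hkM : k < M) :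
    ∑ j ∈ Finset.range M, Real.cos (k * (2 * Real.pi * j / M)) = 0 := by
  have hM : M ≠ 0 := by omega
  have hζ := Complex.isPrimitiveRoot_exp M hM
  have hne : Complex.exp (2 * Real.pi * Complex.I / M) ^ k ≠ 1 :=
    hζ.pow_ne_one_of_pos_of_lt hk.ne' hkM
  have hsum : ∑ j ∈ Finset.range M, (Complex.exp (2 * Real.pi * Complex.I / M) ^ k) ^ j = 0 := by
    rw [geom_sum_eq hne, ← pow_mul, mul_comm k M, pow_mul, hζ.pow_eq_one]
    simp
  have hre := congrArg Complex.re hsum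
  rw [Complex.re_sum, Complex.zero_re] at hre
  rw [← hre]
  refine Finset.sum_congr rfl fun j _ => ?_
  rw [← pow_mul, ← Complex.exp_nat_mul, ← Complex.exp_ofReal_mul_I_re]
  congr 2
  push_cast
  ring

/-- Discrete orthogonality of cosines on the `M`-th roots of unity. -/
lemma sum_cos_mul_cos {M m n : ℕ} (hn : 0 < n) (hmn : m + n < M) :
    ∑ j ∈ Finset.range M, Real.cos (m * (2 * Real.pi * j / M)) *
        Real.cos (n * (2 * Real.pi * j / M)) =
      if m = n then (M : ℝ) / 2 else 0 := by
  have hadd := sum_cos_mul_two_pi_div (M := M) (k := m + n) (by omega) hmn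
  have key : ∀ d : ℕ, ((d : ℝ) = m - n ∨ (d : ℝ) = n - m) →
      ∑ j ∈ Finset.range M, Real.cos (m * (2 * Real.pi * j / M)) *
        Real.cos (n * (2 * Real.pi * j / M)) =
      1 / 2 * ∑ j ∈ Finset.range M, Real.cos (d * (2 * Real.pi * j / M)) := by
    intro d hd
    have h : ∀ x : ℝ, Real.cos (d * x) = Real.cos (m * x - n * x) := by
      intro x
      rcases hd with hd | hd
      · rw [hd, sub_mul]
      · rw [hd, sub_mul, ← Real.cos_neg, neg_sub]
    calc _ = ∑ j ∈ Finset.range M, 1 / 2 * (Real.cos (d * (2 * Real.pi * j / M)) +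
          Real.cos ((m + n : ℕ) * (2 * Real.pi * j / M))) := by
          refine Finset.sum_congr rfl fun j _ => ?_
          push_cast
          rw [h, add_mul, Real.cos_add, Real.cos_sub]
          ring
      _ = _ := by rw [← Finset.mul_sum, Finset.sum_add_distrib, hadd, add_zero]
  rcases lt_trichotomy m n with h | h | h
  · rw [if_neg h.ne, key (n - m) (Or.inr (by push_cast [h.le]; ring)),
      sum_cos_mul_two_pi_div (by omega) (by omega), mul_zero]
  · rw [if_pos h, key 0 (Or.inl (by simp [h]))]
    simp
    ring
  · rw [if_neg h.ne', key (m - n) (Or.inl (by push_cast [h.le]; ring)),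
      sum_cos_mul_two_pi_div (by omega) (by omega), mul_zero]

lemma T_eval_add_inv {v : ℂ} (hv : v ≠ 0) (n : ℕ) :
    aeval (v + v⁻¹) (T n) = v ^ n + v⁻¹ ^ n := by
  induction n using Nat.twoStepInduction with
  | zero => simp [T]; norm_num
  | one => simp [T]
  | more n h₁ h₂ =>
    rw [T, map_sub, map_mul, aeval_X, h₁, h₂]
    linear_combination (v ^ n + v⁻¹ ^ n) * mul_inv_cancel₀ hv

lemma exists_add_inv_eq (x : ℝ) :
    (∃ ψ : ℝ, (x : ℂ) = Complex.exp (ψ * Complex.I) + (Complex.exp (ψ * Complex.I))⁻¹) ∨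
      ∃ σ t : ℝ, (σ = 1 ∨ σ = -1) ∧ 0 ≤ t ∧
        (x : ℂ) = (σ * Real.exp (-t) : ℝ) + ((σ * Real.exp (-t) : ℝ) : ℂ)⁻¹ := by
  by_cases hx : |x| ≤ 2
  · left
    rw [abs_le] at hx
    refine ⟨Real.arccos (x / 2), ?_⟩
    have h := Complex.two_cos (Real.arccos (x / 2))
    rw [neg_mul, Complex.exp_neg] at h
    rw [← h, ← Complex.ofReal_cos, Real.cos_arccos (by linarith) (by linarith)]
    push_cast
    ring
  · right
    push Not at hx
    have key : |x| = Real.exp (-Real.arcosh (|x| / 2)) + (Real.exp (-Real.arcosh (|x| / 2)))⁻¹ := by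
      have h := Real.cosh_arcosh (x := |x| / 2) (by linarith)
      rw [Real.cosh_eq] at h
      rw [← Real.exp_neg, neg_neg]
      linarith
    rcases abs_cases x with ⟨h, _⟩ | ⟨h, _⟩
    · refine ⟨1, Real.arcosh (|x| / 2), Or.inl rfl, Real.arcosh_nonneg (by linarith), ?_⟩
      rw [one_mul, ← Complex.ofReal_inv, ← Complex.ofReal_add, ← key, h]
    · refine ⟨-1, Real.arcosh (|x| / 2), Or.inr rfl, Real.arcosh_nonneg (by linarith), ?_⟩
      rw [neg_one_mul, ← Complex.ofReal_inv, ← Complex.ofReal_add, inv_neg, ← neg_add, ← key, h,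
        neg_neg]

lemma mul_add_sum_sinh_nonneg {D : ℕ} {κ : ℕ → ℝ} {σ : ℝ}
    (hcosh : ∀ t : ℝ, 0 ≤ ∑ n ∈ Finset.range (D + 1), κ n * (σ ^ n * Real.cosh (n * t)))
    {t : ℝ} (ht : 0 ≤ t) :
    0 ≤ κ 0 * t + ∑ n ∈ Finset.Icc 1 D, κ n / n * (σ ^ n * Real.sinh (n * t)) := by
  have hder : ∀ s : ℝ, HasDerivAt
      (fun s => κ 0 * s + ∑ n ∈ Finset.Icc 1 D, κ n / n * (σ ^ n * Real.sinh (n * s)))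
      (∑ n ∈ Finset.range (D + 1), κ n * (σ ^ n * Real.cosh (n * s))) s := by
    intro s
    rw [Finset.sum_range_eq_add_Ico _ (by omega)]
    refine HasDerivAt.add ?_ ?_
    · simpa using (hasDerivAt_id s).const_mul (κ 0)
    · have : Finset.Ico 1 (D + 1) = Finset.Icc 1 D := by ext; simp
      rw [this]
      refine HasDerivAt.fun_sum fun n hn => ?_
      have hn' : (n : ℝ) ≠ 0 := by
        have := (Finset.mem_Icc.1 hn).1
        positivity
      convert! ((((hasDerivAt_id s).const_mul (n : ℝ)).sinh.const_mul (σ ^ n)).const_mul (κ n / n))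
        using 1
      simp
      field_simp
  have hmono : Monotone
      (fun s => κ 0 * s + ∑ n ∈ Finset.Icc 1 D, κ n / n * (σ ^ n * Real.sinh (n * s))) :=
    monotone_of_deriv_nonneg (fun s => (hder s).differentiableAt)
      fun s => (hder s).deriv ▸ hcosh s
  simpa using hmono ht

lemma mul_log_norm_add_sum_le {D : ℕ} {κ : ℕ → ℝ}
    (hcosh : ∀ σ : ℝ, σ = 1 ∨ σ = -1 → ∀ t : ℝ,
      0 ≤ ∑ n ∈ Finset.range (D + 1), κ n * (σ ^ n * Real.cosh (n * t))) (x : ℝ) :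
    ∃ v : ℂ, v ≠ 0 ∧ ‖v‖ ≤ 1 ∧ (x : ℂ) = v + v⁻¹ ∧
      κ 0 * Real.log ‖v‖ + ∑ n ∈ Finset.Icc 1 D, κ n / n * (v ^ n).re ≤
        1 / 2 * ∑ n ∈ Finset.Icc 1 D, κ n / n * (T n).eval x := by
  have heval : ∀ v : ℂ, v ≠ 0 → (x : ℂ) = v + v⁻¹ → ∀ n,
      (T n).eval x = (v ^ n).re + (v⁻¹ ^ n).re := by
    intro v hv hx n
    have h := T_eval_add_inv hv n
    rw [← hx] at h
    rw [← Complex.add_re, ← h]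
    have : aeval (x : ℂ) (T n) = (((T n).eval x : ℝ) : ℂ) :=
      Polynomial.aeval_algebraMap_apply_eq_algebraMap_eval x (T n)
    rw [this, Complex.ofReal_re]
  rcases exists_add_inv_eq x with ⟨ψ, hx⟩ | ⟨σ, t, hσ, ht, hx⟩
  · refine ⟨_, Complex.exp_ne_zero _, (Complex.norm_exp_ofReal_mul_I ψ).le, hx, ?_⟩
    rw [Complex.norm_exp_ofReal_mul_I, Real.log_one, mul_zero, zero_add, Finset.mul_sum]
    refine (Finset.sum_congr rfl fun n _ => ?_).le
    rw [heval _ (Complex.exp_ne_zero _) hx, ← Complex.exp_neg, ← Complex.exp_nat_mul,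
      ← Complex.exp_nat_mul]
    have h1 : (Complex.exp (n * (ψ * Complex.I))).re = Real.cos (n * ψ) := by
      rw [← Complex.exp_ofReal_mul_I_re]; push_cast; ring_nf
    have h2 : (Complex.exp (n * -(ψ * Complex.I))).re = Real.cos (n * ψ) := by
      rw [← Real.cos_neg, ← Complex.exp_ofReal_mul_I_re]; push_cast; ring_nf
    rw [h1, h2]
    ring
  · have hσ2 : σ⁻¹ = σ := by rcases hσ with rfl | rfl <;> norm_num
    have hσ0 : σ ≠ 0 := by rcases hσ with rfl | rfl <;> norm_num
    have hnorm : ‖((σ * Real.exp (-t) : ℝ) : ℂ)‖ = Real.exp (-t) := by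
      have : |σ| = 1 := by rcases hσ with rfl | rfl <;> norm_num
      rw [Complex.norm_real, norm_mul, Real.norm_eq_abs, this, one_mul, Real.norm_eq_abs,
        Real.abs_exp]
    have hv : ((σ * Real.exp (-t) : ℝ) : ℂ) ≠ 0 :=
      Complex.ofReal_ne_zero.2 (mul_ne_zero hσ0 (Real.exp_ne_zero _))
    refine ⟨_, hv, ?_, hx, ?_⟩
    · rw [hnorm]
      exact Real.exp_le_one_iff.2 (by linarith)
    · have h := mul_add_sum_sinh_nonneg (hcosh σ hσ) ht
      rw [hnorm, Real.log_exp, Finset.mul_sum]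
      have hsum : ∑ n ∈ Finset.Icc 1 D, 1 / 2 * (κ n / n * (T n).eval x) =
          ∑ n ∈ Finset.Icc 1 D, κ n / n * (σ ^ n * Real.sinh (n * t)) +
          ∑ n ∈ Finset.Icc 1 D, κ n / n * (((σ * Real.exp (-t) : ℝ) : ℂ) ^ n).re := by
        rw [← Finset.sum_add_distrib]
        refine Finset.sum_congr rfl fun n _ => ?_
        rw [heval _ hv hx, ← Complex.ofReal_inv, ← Complex.ofReal_pow, ← Complex.ofReal_pow,
          Complex.ofReal_re, Complex.ofReal_re, mul_inv, hσ2, ← Real.exp_neg, mul_pow, mul_pow,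
          ← Real.exp_nat_mul, ← Real.exp_nat_mul, Real.sinh_eq]
        ring_nf
      rw [hsum]
      linarith

/-- A finite quadrature version of the Fourier expansion of `log |2 cos θ - x|`, tested against the
nonnegative trigonometric polynomial with coefficients `-κ n`. -/
lemma exists_weights_sum_log_le {D : ℕ} {κ : ℕ → ℝ} (hκ : ∀ n, D < n → κ n = 0)
    (hcos : ∀ θ : ℝ, ∑ n ∈ Finset.range (D + 1), κ n * Real.cos (n * θ) ≤ 0)
    (hcosh : ∀ σ : ℝ, σ = 1 ∨ σ = -1 → ∀ t : ℝ,
      0 ≤ ∑ n ∈ Finset.range (D + 1), κ n * (σ ^ n * Real.cosh (n * t)))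
    {ε : ℝ} (hε : 0 < ε) :
    ∃ (M : ℕ) (θ w : ℕ → ℝ), (∀ j, 0 ≤ w j) ∧ ∑ j ∈ Finset.range M, w j = -κ 0 ∧
      ∀ x : ℝ, (∀ j ∈ Finset.range M, x ≠ 2 * Real.cos (θ j)) →
        ∑ j ∈ Finset.range M, w j * Real.log |2 * Real.cos (θ j) - x| ≤
          1 / 2 * ∑ n ∈ Finset.Icc 1 D, κ n / n * (T n).eval x + ε := by
  set B : ℝ := 2 * |κ 0| + ∑ n ∈ Finset.Icc 1 D, |κ n| with hB
  have hB0 : 0 ≤ B := add_nonneg (by positivity) (Finset.sum_nonneg fun n _ => abs_nonneg _)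
  obtain ⟨L, b, hDL, hb, hlog⟩ := exists_log_norm_one_sub_majorant D
    (show 0 < ε / (B + 1) from div_pos hε (by linarith))
  set δ := ε / (B + 1) with hδ
  have hδB : δ * B ≤ ε := by
    rw [hδ, div_mul_eq_mul_div, div_le_iff₀ (by linarith)]
    nlinarith
  set M := D + L + 1 with hM
  have hM0 : (0 : ℝ) < M := by rw [hM]; positivity
  set θ : ℕ → ℝ := fun j => 2 * Real.pi * j / M with hθ
  set w : ℕ → ℝ := fun j => -(1 / M * ∑ n ∈ Finset.range (D + 1), κ n * Real.cos (n * θ j)) with hw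
  have hw0 : ∀ j, 0 ≤ w j := fun j =>
    neg_nonneg.2 (mul_nonpos_of_nonneg_of_nonpos (by positivity) (hcos _))
  have hwcos : ∀ n, 1 ≤ n → n ≤ L → ∑ j ∈ Finset.range M, w j * Real.cos (n * θ j) = -κ n / 2 := by
    intro n hn1 hnL
    have h1 : ∀ m ∈ Finset.range (D + 1), ∑ j ∈ Finset.range M,
        Real.cos (m * θ j) * Real.cos (n * θ j) = if m = n then (M : ℝ) / 2 else 0 := by
      intro m hm
      exact sum_cos_mul_cos (by omega) (by have := Finset.mem_range.1 hm; omega)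
    calc _ = -(1 / M * ∑ m ∈ Finset.range (D + 1), κ m *
          ∑ j ∈ Finset.range M, Real.cos (m * θ j) * Real.cos (n * θ j)) := by
          simp only [hw, Finset.mul_sum, ← Finset.sum_neg_distrib, Finset.sum_mul]
          rw [Finset.sum_comm]
          refine Finset.sum_congr rfl fun m _ => Finset.sum_congr rfl fun j _ => by ring
      _ = -(1 / M * ∑ m ∈ Finset.range (D + 1), if m = n then κ m * ((M : ℝ) / 2) else 0) := by
          congr 2
          refine Finset.sum_congr rfl fun m hm => ?_
          rw [h1 m hm, mul_ite, mul_zero]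
      _ = _ := by
          rw [Finset.sum_ite_eq']
          split_ifs with h
          · field_simp
          · rw [hκ n (by simpa using h)]; simp
  have hwsum : ∑ j ∈ Finset.range M, w j = -κ 0 := by
    have hs : ∑ j ∈ Finset.range M, ∑ n ∈ Finset.range (D + 1), κ n * Real.cos (n * θ j) =
        M * κ 0 := by
      rw [Finset.sum_comm, Finset.sum_eq_single 0]
      · simp
      · intro n hn hn0
        rw [← Finset.mul_sum, sum_cos_mul_two_pi_div (by omega)
          (by have := Finset.mem_range.1 hn; omega), mul_zero]
      · simp
    rw [hw, Finset.sum_neg_distrib, ← Finset.mul_sum, hs]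
    field_simp
  refine ⟨M, θ, w, hw0, hwsum, fun x hx => ?_⟩
  obtain ⟨v, hv0, hv1, hxv, hle⟩ := mul_log_norm_add_sum_le hcosh x
  have hterm : ∀ j ∈ Finset.range M, Real.log |2 * Real.cos (θ j) - x| ≤
      -Real.log ‖v‖ + 2 * δ - 2 * ∑ n ∈ Finset.Icc 1 L, b n * (v ^ n).re * Real.cos (n * θ j) := by
    intro j hj
    set z := Complex.exp (θ j * Complex.I) with hz
    have hz0 : z ≠ 0 := Complex.exp_ne_zero _
    have hzn : ‖z‖ = 1 := Complex.norm_exp_ofReal_mul_I _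
    have hcosz : ((2 * Real.cos (θ j) : ℝ) : ℂ) = z + z⁻¹ := by
      have h := Complex.two_cos (θ j)
      rw [neg_mul, Complex.exp_neg] at h
      rw [Complex.ofReal_mul, Complex.ofReal_cos, Complex.ofReal_ofNat, h]
    have hfac : ((2 * Real.cos (θ j) - x : ℝ) : ℂ) = -(v⁻¹ * ((1 - v * z) * (1 - v * z⁻¹))) := by
      rw [Complex.ofReal_sub, hcosz, hxv]
      field_simp
      ring
    have hne : (2 * Real.cos (θ j) - x : ℝ) ≠ 0 := sub_ne_zero.2 (hx j hj).symm
    have hne' := Complex.ofReal_ne_zero.2 hne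
    rw [hfac, neg_ne_zero, mul_ne_zero_iff, mul_ne_zero_iff] at hne'
    obtain ⟨hvi, h1, h2⟩ := hne'
    rw [← Real.norm_eq_abs, ← Complex.norm_real, hfac, norm_neg, norm_mul, norm_mul,
      Real.log_mul (norm_ne_zero_iff.2 hvi)
        (mul_ne_zero (norm_ne_zero_iff.2 h1) (norm_ne_zero_iff.2 h2)),
      Real.log_mul (norm_ne_zero_iff.2 h1) (norm_ne_zero_iff.2 h2), norm_inv, Real.log_inv]
    have l1 := hlog (v * z) (by rw [norm_mul, hzn, mul_one]; exact hv1)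
      (fun h => h1 (by rw [h, sub_self]))
    have l2 := hlog (v * z⁻¹) (by rw [norm_mul, norm_inv, hzn, inv_one, mul_one]; exact hv1)
      (fun h => h2 (by rw [h, sub_self]))
    have hs : ∑ n ∈ Finset.Icc 1 L, b n * ((v * z) ^ n).re +
        ∑ n ∈ Finset.Icc 1 L, b n * ((v * z⁻¹) ^ n).re =
        2 * ∑ n ∈ Finset.Icc 1 L, b n * (v ^ n).re * Real.cos (n * θ j) := by
      rw [← Finset.sum_add_distrib, Finset.mul_sum]
      refine Finset.sum_congr rfl fun n _ => ?_
      have h3 : (v * z) ^ n + (v * z⁻¹) ^ n = ((2 * Real.cos (n * θ j) : ℝ) : ℂ) * v ^ n := by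
        have h := Complex.two_cos (n * θ j)
        rw [Complex.ofReal_mul, Complex.ofReal_cos, Complex.ofReal_ofNat, Complex.ofReal_mul,
          Complex.ofReal_natCast, h, mul_pow, mul_pow, hz, ← Complex.exp_neg, ← Complex.exp_nat_mul,
          ← Complex.exp_nat_mul]
        ring_nf
      rw [← mul_add, ← Complex.add_re, h3, Complex.re_ofReal_mul]
      ring
    linarith
  have hsum : ∑ j ∈ Finset.range M, w j * Real.log |2 * Real.cos (θ j) - x| ≤
      κ 0 * Real.log ‖v‖ - 2 * δ * κ 0 + ∑ n ∈ Finset.Icc 1 L, b n * (v ^ n).re * κ n := by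
    calc _ ≤ ∑ j ∈ Finset.range M, w j * (-Real.log ‖v‖ + 2 * δ -
          2 * ∑ n ∈ Finset.Icc 1 L, b n * (v ^ n).re * Real.cos (n * θ j)) :=
          Finset.sum_le_sum fun j hj => mul_le_mul_of_nonneg_left (hterm j hj) (hw0 j)
      _ = (-Real.log ‖v‖ + 2 * δ) * ∑ j ∈ Finset.range M, w j -
          2 * ∑ n ∈ Finset.Icc 1 L, b n * (v ^ n).re *
            ∑ j ∈ Finset.range M, w j * Real.cos (n * θ j) := by
          simp only [Finset.mul_sum]
          rw [Finset.sum_comm, ← Finset.sum_sub_distrib]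
          refine Finset.sum_congr rfl fun j _ => ?_
          rw [mul_sub, Finset.mul_sum]
          congr 1
          · ring
          · exact Finset.sum_congr rfl fun n _ => by ring
      _ = _ := by
          rw [hwsum]
          have : ∀ n ∈ Finset.Icc 1 L, b n * (v ^ n).re *
              ∑ j ∈ Finset.range M, w j * Real.cos (n * θ j) =
              -(1 / 2) * (b n * (v ^ n).re * κ n) := by
            intro n hn
            rw [hwcos n (Finset.mem_Icc.1 hn).1 (Finset.mem_Icc.1 hn).2]
            ring
          rw [Finset.sum_congr rfl this, ← Finset.mul_sum]
          ring
  have htrunc : ∑ n ∈ Finset.Icc 1 L, b n * (v ^ n).re * κ n =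
      ∑ n ∈ Finset.Icc 1 D, b n * (v ^ n).re * κ n := by
    refine (Finset.sum_subset (Finset.Icc_subset_Icc_right hDL) fun n hn hn' => ?_).symm
    rw [hκ n, mul_zero]
    simp only [Finset.mem_Icc] at hn hn'
    omega
  have hclose : ∑ n ∈ Finset.Icc 1 D, b n * (v ^ n).re * κ n ≤
      ∑ n ∈ Finset.Icc 1 D, κ n / n * (v ^ n).re + δ * ∑ n ∈ Finset.Icc 1 D, |κ n| := by
    rw [Finset.mul_sum, ← Finset.sum_add_distrib]
    refine Finset.sum_le_sum fun n hn => ?_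
    have hre : |(v ^ n).re| ≤ 1 :=
      (Complex.abs_re_le_norm _).trans (by rw [norm_pow]; exact pow_le_one₀ (norm_nonneg _) hv1)
    have h1 : (b n - 1 / n) * (v ^ n).re * κ n ≤ δ * |κ n| := by
      refine (le_abs_self _).trans ?_
      rw [abs_mul, abs_mul]
      refine mul_le_mul_of_nonneg_right ?_ (abs_nonneg _)
      calc _ ≤ δ * 1 := mul_le_mul (hb n hn) hre (abs_nonneg _) ((abs_nonneg _).trans (hb n hn))
        _ = δ := mul_one _
    have h2 : b n * (v ^ n).re * κ n = (b n - 1 / n) * (v ^ n).re * κ n + κ n / n * (v ^ n).re := by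
      ring
    linarith
  have hδ0 : 0 ≤ δ := div_nonneg hε.le (by linarith)
  have hκ0 := mul_le_mul_of_nonneg_left (neg_le_abs (κ 0)) hδ0
  have : δ * B = 2 * (δ * |κ 0|) + δ * ∑ n ∈ Finset.Icc 1 D, |κ n| := by rw [hB]; ring
  linarith

/-- The weighted shift on `ℂ^{ZMod N}` sending `e_j` to `P j • e_{j-1}`. -/
def cyclicShift {N : ℕ} (P : ZMod N → ℝ) : Matrix (ZMod N) (ZMod N) ℂ :=
  Matrix.of fun i j => if j = i + 1 then (P j : ℂ) else 0

/-- The periodic Jacobi matrix with weights `P`, `Q` and hopping phase `ω`. -/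
def cyclicJacobi {N : ℕ} (P Q : ZMod N → ℝ) (ω : ℂ) : Matrix (ZMod N) (ZMod N) ℂ :=
  Matrix.diagonal (fun j => (Q j : ℂ)) + ω • cyclicShift P + ω⁻¹ • (cyclicShift P).transpose

lemma cyclicJacobi_isHermitian {N : ℕ} (P Q : ZMod N → ℝ) {ω : ℂ} (hω : ‖ω‖ = 1) :
    (cyclicJacobi P Q ω).IsHermitian := by
  have hc : star ω = ω⁻¹ := by
    rw [Complex.inv_def, Complex.normSq_eq_norm_sq, hω]
    simp
  have hc' : star ω⁻¹ = ω := by rw [← hc, star_star]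
  have hS : (cyclicShift P).conjTranspose = (cyclicShift P).transpose := by
    ext i j
    simp only [cyclicShift, Matrix.conjTranspose_apply, Matrix.transpose_apply, Matrix.of_apply]
    split_ifs <;> simp
  have hS' : (cyclicShift P).transpose.conjTranspose = cyclicShift P := by
    rw [← hS, Matrix.conjTranspose_conjTranspose]
  rw [Matrix.IsHermitian, cyclicJacobi, Matrix.conjTranspose_add, Matrix.conjTranspose_add,
    Matrix.conjTranspose_smul, Matrix.conjTranspose_smul, hS, hS', hc, hc',
    Matrix.diagonal_conjTranspose, add_assoc, add_comm (ω⁻¹ • _), ← add_assoc]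
  congr 3
  ext j
  simp

lemma norm_det_cyclicShift {N : ℕ} [NeZero N] (P : ZMod N → ℝ) (hP : ∀ i, 0 < P i) :
    ‖(cyclicShift P).det‖ = ∏ i, P i := by
  have h : cyclicShift P =
      (Matrix.diagonal (fun j => (P j : ℂ))).submatrix (Equiv.addRight (1 : ZMod N)) id := by
    ext i j
    simp only [cyclicShift, Matrix.of_apply, Matrix.submatrix_apply, Matrix.diagonal_apply,
      Equiv.coe_addRight, id, eq_comm (a := j)]
    split_ifs with h
    · rw [h]
    · rfl
  rw [h, Matrix.det_permute, Matrix.det_diagonal, norm_mul, norm_prod]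
  have hs : ‖((Equiv.Perm.sign (Equiv.addRight (1 : ZMod N)) : ℤ) : ℂ)‖ = 1 := by
    rcases Int.units_eq_one_or (Equiv.Perm.sign (Equiv.addRight (1 : ZMod N))) with h | h <;>
      simp [h]
  rw [hs, one_mul]
  exact Finset.prod_congr rfl fun i _ => by
    rw [Complex.norm_real, Real.norm_of_nonneg (hP i).le]

/-- The characteristic determinant of `cyclicJacobi P Q ω` at `x`, cleared of denominators in
`ω`. -/
def cyclicDet {N : ℕ} [NeZero N] (P Q : ZMod N → ℝ) (x : ℝ) : ℂ[X] :=
  Matrix.det (Matrix.of fun i j => Polynomial.C (-(cyclicShift P).transpose i j) +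
    Polynomial.X * Polynomial.C ((Matrix.diagonal (fun j => (x : ℂ) - Q j)) i j) -
    Polynomial.X ^ 2 * Polynomial.C (cyclicShift P i j))

lemma cyclicDet_eval {N : ℕ} [NeZero N] (P Q : ZMod N → ℝ) (x : ℝ) (ω : ℂ) :
    (cyclicDet P Q x).eval ω = (-(cyclicShift P).transpose +
      ω • (Matrix.diagonal (fun j => (x : ℂ) - Q j)) - ω ^ 2 • cyclicShift P).det := by
  rw [cyclicDet, ← Polynomial.coe_evalRingHom, RingHom.map_det]
  congr 1
  ext i j
  simp [Matrix.map_apply]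
  ring

lemma norm_cyclicDet_coeff_zero {N : ℕ} [NeZero N] (P Q : ZMod N → ℝ) (hP : ∀ i, 0 < P i) (x : ℝ) :
    ‖(cyclicDet P Q x).coeff 0‖ = ∏ i, P i := by
  rw [Polynomial.coeff_zero_eq_eval_zero, cyclicDet_eval, zero_smul, zero_pow two_ne_zero,
    zero_smul, add_zero, sub_zero, Matrix.det_neg, Matrix.det_transpose, norm_mul,
    norm_det_cyclicShift P hP, norm_pow, norm_neg, norm_one, one_pow, one_mul]

lemma norm_cyclicDet_eval {N : ℕ} [NeZero N] (P Q : ZMod N → ℝ) (x : ℝ) {ω : ℂ} (hω : ‖ω‖ = 1) :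
    ‖(cyclicDet P Q x).eval ω‖ =
      ∏ i, |x - (cyclicJacobi_isHermitian P Q hω).eigenvalues i| := by
  have hω0 : ω ≠ 0 := norm_ne_zero_iff.1 (by rw [hω]; exact one_ne_zero)
  have h : -(cyclicShift P).transpose + ω • (Matrix.diagonal (fun j => (x : ℂ) - Q j)) -
      ω ^ 2 • cyclicShift P = ω • (Matrix.scalar (ZMod N) (x : ℂ) - cyclicJacobi P Q ω) := by
    have hd : Matrix.diagonal (fun j => (x : ℂ) - Q j) =
        Matrix.scalar (ZMod N) (x : ℂ) - Matrix.diagonal (fun j => (Q j : ℂ)) := by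
      rw [Matrix.scalar_apply, Matrix.diagonal_sub]
    rw [hd, cyclicJacobi]
    simp only [smul_sub, smul_add, smul_smul, mul_inv_cancel₀ hω0, one_smul, pow_two]
    abel
  rw [cyclicDet_eval, h, Matrix.det_smul, norm_mul, norm_pow, hω, one_pow, one_mul,
    ← Matrix.eval_charpoly, (cyclicJacobi_isHermitian P Q hω).charpoly_eq, Polynomial.eval_prod,
    norm_prod]
  refine Finset.prod_congr rfl fun i _ => ?_
  rw [Polynomial.eval_sub, Polynomial.eval_X, Polynomial.eval_C, ← Real.norm_eq_abs,
    ← Complex.norm_real, Complex.ofReal_sub]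
  rfl

lemma Matrix.IsHermitian.trace_aeval {ι : Type*} [Fintype ι] [DecidableEq ι] {A : Matrix ι ι ℂ}
    (hA : A.IsHermitian) (R : ℝ[X]) :
    (aeval A R).trace = ((∑ i, R.eval (hA.eigenvalues i) : ℝ) : ℂ) := by
  rw [← cfc_polynomial R A hA.isSelfAdjoint, Matrix.trace_eq_sum_roots_charpoly,
    hA.charpoly_cfc_eq, Polynomial.roots_prod]
  · simp
  · exact Finset.prod_ne_zero_iff.2 fun i _ => Polynomial.X_sub_C_ne_zero _

lemma circleAverage_le_of_finite {f : ℂ → ℝ} (hf : CircleIntegrable f 0 1) {S : Set ℂ}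
    (hS : S.Finite) {a : ℝ} (h : ∀ z : ℂ, ‖z‖ = 1 → z ∉ S → f z ≤ a) :
    Real.circleAverage f 0 1 ≤ a := by
  have hfg : f =ᶠ[Filter.codiscreteWithin (Metric.sphere 0 |1|)] fun z => min (f z) a := by
    refine codiscreteWithin_iff_locallyFiniteComplementWithin.2 fun z _ =>
      ⟨Set.univ, Filter.univ_mem, hS.subset ?_⟩
    rintro y ⟨-, hy, hy'⟩
    by_contra hyS
    rw [mem_sphere_zero_iff_norm, abs_one] at hy
    exact hy' (min_eq_left (h y hy hyS)).symm
  rw [Real.circleAverage_congr_codiscreteWithin hfg one_ne_zero]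
  exact Real.circleAverage_mono_on_of_le_circle (hf.congr_codiscreteWithin hfg)
    fun z _ => min_le_right _ _

lemma circleIntegrable_log_norm_eval (p : ℂ[X]) :
    CircleIntegrable (fun z => Real.log ‖p.eval z‖) 0 1 :=
  p.intervalIntegrable_mahlerMeasure

lemma log_norm_coeff_zero_le_circleAverage {p : ℂ[X]} (hp : p.coeff 0 ≠ 0) :
    Real.log ‖p.coeff 0‖ ≤ Real.circleAverage (fun z => Real.log ‖p.eval z‖) 0 1 := by
  have h := p.norm_coeff_le_choose_mul_mahlerMeasure 0
  rw [Nat.choose_zero_right, Nat.cast_one, one_mul] at h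
  have h' := Real.log_le_log (norm_pos_iff.2 hp) h
  rwa [← Polynomial.logMahlerMeasure_eq_log_MahlerMeasure, Polynomial.logMahlerMeasure_def] at h'

/-- The sum rule inequality for periodic Jacobi matrices whose Chebyshev traces do not depend on
the hopping phase. -/
lemma cyclic_sum_rule {D : ℕ} {κ : ℕ → ℝ} (hκ : ∀ n, D < n → κ n = 0)
    (hcos : ∀ θ : ℝ, ∑ n ∈ Finset.range (D + 1), κ n * Real.cos (n * θ) ≤ 0)
    (hcosh : ∀ σ : ℝ, σ = 1 ∨ σ = -1 → ∀ t : ℝ,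
      0 ≤ ∑ n ∈ Finset.range (D + 1), κ n * (σ ^ n * Real.cosh (n * t)))
    {N : ℕ} [NeZero N] {P Q : ZMod N → ℝ} (hP : ∀ i, 0 < P i) {τ : ℕ → ℝ}
    (hτ : ∀ ω : ℂ, ‖ω‖ = 1 → ∀ n ∈ Finset.Icc 1 D,
      (aeval (cyclicJacobi P Q ω) (T n)).trace = τ n) :
    0 ≤ κ 0 * (2 * Real.log (∏ i, P i)) + ∑ n ∈ Finset.Icc 1 D, κ n / n * τ n := by
  refine le_of_forall_pos_le_add fun η hη => ?_
  have hN : (0 : ℝ) < N := Nat.cast_pos.2 (Nat.pos_of_neZero N)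
  obtain ⟨M, θ, w, hw0, hwsum, hw⟩ := exists_weights_sum_log_le hκ hcos hcosh
    (show 0 < η / (2 * N) by positivity)
  have hPpos : 0 < ∏ i, P i := Finset.prod_pos fun i _ => hP i
  set f : ℕ → ℂ[X] := fun j => cyclicDet P Q (2 * Real.cos (θ j)) with hf
  have hf0 : ∀ j, ‖(f j).coeff 0‖ = ∏ i, P i := fun j => norm_cyclicDet_coeff_zero P Q hP _
  have hf0' : ∀ j, (f j).coeff 0 ≠ 0 := fun j => norm_pos_iff.1 (hf0 j ▸ hPpos)
  have hcirc : ∀ j ∈ Finset.range M,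
      CircleIntegrable (fun z => w j * Real.log ‖(f j).eval z‖) 0 1 := fun j _ => by
    simpa only [Pi.smul_def, smul_eq_mul] using
      (circleIntegrable_log_norm_eval (f j)).const_smul (a := w j)
  have havg : Real.circleAverage
      (fun z => ∑ j ∈ Finset.range M, w j * Real.log ‖(f j).eval z‖) 0 1 ≤
      1 / 2 * ∑ n ∈ Finset.Icc 1 D, κ n / n * τ n + η / 2 := by
    refine circleAverage_le_of_finite (CircleIntegrable.fun_sum _ hcirc)
      (S := ⋃ j ∈ Finset.range M, {z | (f j).IsRoot z}) ?_ ?_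
    · refine Set.Finite.biUnion (Finset.finite_toSet _) fun j _ =>
        Polynomial.finite_setOfPred_isRoot ?_
      intro h
      exact hf0' j (by rw [h, Polynomial.coeff_zero])
    · intro z hz hzS
      have hz' : ∀ j ∈ Finset.range M, (f j).eval z ≠ 0 := by
        intro j hj h0
        exact hzS (Set.mem_biUnion hj h0)
      set lam := (cyclicJacobi_isHermitian P Q hz).eigenvalues with hlam
      have hprod : ∀ j, ‖(f j).eval z‖ = ∏ i, |2 * Real.cos (θ j) - lam i| :=
        fun j => norm_cyclicDet_eval P Q _ hz
      have hne : ∀ j ∈ Finset.range M, ∀ i, 2 * Real.cos (θ j) - lam i ≠ 0 := by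
        intro j hj i h0
        refine hz' j hj (norm_eq_zero.1 ?_)
        rw [hprod]
        exact Finset.prod_eq_zero (Finset.mem_univ i) (by rw [h0, abs_zero])
      have htr : ∀ n ∈ Finset.Icc 1 D, ∑ i, (T n).eval (lam i) = τ n := by
        intro n hn
        have h := (cyclicJacobi_isHermitian P Q hz).trace_aeval (T n)
        rw [hτ z hz n hn] at h
        exact (Complex.ofReal_injective h).symm
      calc _ = ∑ i, ∑ j ∈ Finset.range M, w j * Real.log |2 * Real.cos (θ j) - lam i| := by
            rw [Finset.sum_comm]
            refine Finset.sum_congr rfl fun j hj => ?_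
            rw [hprod, Real.log_prod fun i _ => abs_ne_zero.2 (hne j hj i), Finset.mul_sum]
        _ ≤ ∑ i, (1 / 2 * ∑ n ∈ Finset.Icc 1 D, κ n / n * (T n).eval (lam i) + η / (2 * N)) := by
            refine Finset.sum_le_sum fun i _ => hw (lam i) fun j hj h => ?_
            exact hne j hj i (sub_eq_zero.2 h.symm)
        _ = _ := by
            rw [Finset.sum_add_distrib, ← Finset.mul_sum, Finset.sum_comm, Finset.sum_const,
              Finset.card_univ, ZMod.card, nsmul_eq_mul]
            congr 1
            · congr 1
              refine Finset.sum_congr rfl fun n hn => ?_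
              rw [← Finset.mul_sum, htr n hn]
            · field_simp
  rw [Real.circleAverage_fun_sum hcirc] at havg
  have hlow : -κ 0 * Real.log (∏ i, P i) ≤ ∑ j ∈ Finset.range M,
      Real.circleAverage (fun z => w j * Real.log ‖(f j).eval z‖) 0 1 := by
    rw [← hwsum, Finset.sum_mul]
    refine Finset.sum_le_sum fun j _ => ?_
    have h1 := log_norm_coeff_zero_le_circleAverage (hf0' j)
    rw [hf0] at h1
    have h2 := Real.circleAverage_fun_smul (c := 0) (R := 1) (a := w j)
      (f := fun z => Real.log ‖(f j).eval z‖)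
    simp only [smul_eq_mul] at h2
    rw [h2]
    exact mul_le_mul_of_nonneg_left h1 (hw0 j)
  linarith

lemma inner_ez (k m : ℤ) : ⟪ez k, ez m⟫ = if k = m then 1 else 0 := by
  rw [ez, ez, lp.inner_single_left, lp.single_apply]
  by_cases h : k = m
  · subst h; simp
  · simp [h]

lemma apply_valMinAbs_eq {α : Type*} {f : ℤ → α} {d : α} {K N : ℕ} [NeZero N]
    (hf : ∀ k : ℤ, K < |k| → f k = d) (hKN : 2 * K < N) {k : ℤ} (hk : |k| + K < N) :
    f ((k : ZMod N).valMinAbs) = f k := by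
  have hmem := ZMod.valMinAbs_mem_Ioc (k : ZMod N)
  have hcast : (((k : ZMod N).valMinAbs : ℤ) : ZMod N) = (k : ZMod N) := ZMod.coe_valMinAbs _
  rw [ZMod.intCast_eq_intCast_iff_dvd_sub] at hcast
  set y := (k : ZMod N).valMinAbs
  by_cases h : |y| ≤ K
  · have : k - y = 0 := by
      refine Int.eq_zero_of_abs_lt_dvd hcast ?_
      rw [abs_le] at h
      rw [abs_lt]
      rw [← lt_sub_iff_add_lt, abs_lt] at hk
      constructor <;> omega
    rw [sub_eq_zero.1 this]
  · by_cases h' : |k| ≤ K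
    · have : k - y = 0 := by
        refine Int.eq_zero_of_abs_lt_dvd hcast ?_
        rw [abs_le] at h'
        rw [abs_lt]
        obtain ⟨h1, h2⟩ := hmem
        constructor <;> omega
      rw [sub_eq_zero.1 this]
    · rw [hf y (by omega), hf k (by omega)]

lemma mul_cyclicJacobi_apply {N : ℕ} [NeZero N] (P Q : ZMod N → ℝ) (ω : ℂ)
    (A : Matrix (ZMod N) (ZMod N) ℂ) (i j : ZMod N) :
    (A * cyclicJacobi P Q ω) i j =
      ω * P j * A i (j - 1) + Q j * A i j + ω⁻¹ * P (j + 1) * A i (j + 1) := by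
  have h : (A * cyclicShift P) i j = A i (j - 1) * P j := by
    rw [Matrix.mul_apply, Finset.sum_eq_single (j - 1)]
    · simp [cyclicShift]
    · intro l _ hl
      have : ¬ j = l + 1 := fun h => hl (by rw [h, add_sub_cancel_right])
      simp [cyclicShift, this]
    · simp
  have h' : (A * (cyclicShift P).transpose) i j = A i (j + 1) * P (j + 1) := by
    rw [Matrix.mul_apply, Finset.sum_eq_single (j + 1)]
    · simp [cyclicShift]
    · intro l _ hl
      simp [cyclicShift, hl]
    · simp
  rw [cyclicJacobi, mul_add, mul_add, Matrix.add_apply, Matrix.add_apply, Matrix.mul_smul,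
    Matrix.mul_smul, Matrix.smul_apply, Matrix.smul_apply, h, h', Matrix.mul_diagonal, smul_eq_mul,
    smul_eq_mul]
  ring

section Jacobi

variable {p q : ℤ → ℝ} {J J₀ : HZ →L[ℝ] HZ}

lemma inner_pow_succ_ez
    (hJ : ∀ k : ℤ, J (ez k) = p k • ez (k - 1) + q k • ez k + p (k + 1) • ez (k + 1))
    (n : ℕ) (k m : ℤ) :
    ⟪(J ^ (n + 1)) (ez k), ez m⟫ = p k * ⟪(J ^ n) (ez (k - 1)), ez m⟫ +
      q k * ⟪(J ^ n) (ez k), ez m⟫ + p (k + 1) * ⟪(J ^ n) (ez (k + 1)), ez m⟫ := by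
  rw [pow_succ, mul_apply_eq_comp, hJ, map_add, map_add, map_smul, map_smul, map_smul,
    inner_add_left, inner_add_left, real_inner_smul_left, real_inner_smul_left,
    real_inner_smul_left]

lemma cyclicJacobi_pow_apply
    (hJ : ∀ k : ℤ, J (ez k) = p k • ez (k - 1) + q k • ez k + p (k + 1) • ez (k + 1))
    {N : ℕ} [NeZero N] {K : ℕ} {P Q : ZMod N → ℝ}
    (hP : ∀ k : ℤ, |k| + K < N → P k = p k) (hQ : ∀ k : ℤ, |k| + K < N → Q k = q k)
    {ω : ℂ} (hω : ω ≠ 0) (n : ℕ) (k m : ℤ) (hkm : |m - k| + n < N) (hk : |k| + n + K < N) :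
    (cyclicJacobi P Q ω ^ n) m k = ω ^ (k - m) * ⟪(J ^ n) (ez k), ez m⟫ := by
  induction n generalizing k with
  | zero =>
    rw [pow_zero, pow_zero, one_apply_eq_self, inner_ez, Matrix.one_apply]
    by_cases h : k = m
    · subst h; simp
    · have : ¬ (m : ZMod N) = (k : ZMod N) := by
        rw [ZMod.intCast_eq_intCast_iff_dvd_sub]
        intro hd
        refine h (sub_eq_zero.1 (Int.eq_zero_of_abs_lt_dvd hd ?_))
        rw [abs_sub_comm]
        simpa using hkm
      simp [h, this]
  | succ n ih =>
    push_cast at hkm hk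
    have hkm' := abs_lt.1 (lt_sub_iff_add_lt.2 hkm)
    have hk' := abs_lt.1 (lt_sub_iff_add_lt.2 (show |k| + (n + 1 + K) < N by omega))
    have bound : ∀ x c : ℤ, -c < x → x < c → |x| < c := fun x c h1 h2 => abs_lt.2 ⟨h1, h2⟩
    rw [inner_pow_succ_ez hJ, pow_succ, mul_cyclicJacobi_apply]
    have e1 := ih (k - 1) (by have := bound (m - (k - 1)) (N - n) (by omega) (by omega); omega)
      (by have := bound (k - 1) (N - n - K) (by omega) (by omega); omega)
    have e2 := ih k (by omega) (by omega)
    have e3 := ih (k + 1) (by have := bound (m - (k + 1)) (N - n) (by omega) (by omega); omega)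
      (by have := bound (k + 1) (N - n - K) (by omega) (by omega); omega)
    have hp1 := hP k (by omega)
    have hp2 := hP (k + 1) (by have := bound (k + 1) (N - K) (by omega) (by omega); omega)
    have hq1 := hQ k (by omega)
    push_cast at e1 e3 hp2
    rw [e1, e2, e3, hp1, hp2, hq1, show k - 1 - m = k - m - 1 by ring,
      show k + 1 - m = k - m + 1 by ring, zpow_sub_one₀ hω, zpow_add_one₀ hω]
    push_cast
    field_simp

lemma inner_aeval_ez (J : HZ →L[ℝ] HZ) {R : ℝ[X]} {n : ℕ} (hR : R.natDegree ≤ n) (k m : ℤ) :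
    ⟪aeval J R (ez k), ez m⟫ =
      ∑ i ∈ Finset.range (n + 1), R.coeff i * ⟪(J ^ i) (ez k), ez m⟫ := by
  rw [Polynomial.aeval_eq_sum_range' (Nat.lt_succ_of_le hR), sum_apply,
    sum_inner]
  refine Finset.sum_congr rfl fun i _ => ?_
  rw [smul_apply, real_inner_smul_left]

lemma aeval_cyclicJacobi_diag
    (hJ : ∀ k : ℤ, J (ez k) = p k • ez (k - 1) + q k • ez k + p (k + 1) • ez (k + 1))
    {N : ℕ} [NeZero N] {K : ℕ} {P Q : ZMod N → ℝ}
    (hP : ∀ k : ℤ, |k| + K < N → P k = p k) (hQ : ∀ k : ℤ, |k| + K < N → Q k = q k)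
    {ω : ℂ} (hω : ω ≠ 0) {R : ℝ[X]} {n : ℕ} (hR : R.natDegree ≤ n) (k : ℤ) (hk : |k| + n + K < N) :
    aeval (cyclicJacobi P Q ω) R k k = (⟪aeval J R (ez k), ez k⟫ : ℝ) := by
  rw [inner_aeval_ez J hR, Polynomial.aeval_eq_sum_range' (Nat.lt_succ_of_le hR),
    Matrix.sum_apply, Complex.ofReal_sum]
  refine Finset.sum_congr rfl fun i hi => ?_
  have hi' : i ≤ n := Nat.lt_succ_iff.1 (Finset.mem_range.1 hi)
  rw [Matrix.smul_apply, cyclicJacobi_pow_apply hJ hP hQ hω i k k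
    (by have := abs_nonneg k; rw [sub_self, abs_zero]; omega) (by omega)]
  simp

lemma inner_pow_ez_eq_free
    (hJ : ∀ k : ℤ, J (ez k) = p k • ez (k - 1) + q k • ez k + p (k + 1) • ez (k + 1))
    (hJ₀ : ∀ k : ℤ, J₀ (ez k) = ez (k - 1) + ez (k + 1)) {K : ℕ}
    (hp : ∀ k : ℤ, K < |k| → p k = 1) (hq : ∀ k : ℤ, K < |k| → q k = 0)
    (n : ℕ) (k m : ℤ) (hk : K + n < |k|) :
    ⟪(J ^ n) (ez k), ez m⟫ = ⟪(J₀ ^ n) (ez k), ez m⟫ := by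
  induction n generalizing k with
  | zero => simp
  | succ n ih =>
    push_cast at hk
    have h1 : K + n < |k - 1| := by
      have := abs_add_le (k - 1) 1
      rw [sub_add_cancel, abs_one] at this
      omega
    have h2 : K + n < |k + 1| := by
      have := abs_sub (k + 1) 1
      rw [add_sub_cancel_right, abs_one] at this
      omega
    have hJ₀' : ∀ k : ℤ,
        J₀ (ez k) = (1 : ℝ) • ez (k - 1) + (0 : ℝ) • ez k + (1 : ℝ) • ez (k + 1) := by
      intro k
      rw [hJ₀, one_smul, one_smul, zero_smul, add_zero]
    rw [inner_pow_succ_ez hJ, inner_pow_succ_ez (p := fun _ => 1) (q := fun _ => 0) hJ₀',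
      hp k (by omega), hq k (by omega), hp (k + 1) (by omega), ih _ h1, ih _ h2]
    ring

end Jacobi

lemma natDegree_T_le (n : ℕ) : (T n).natDegree ≤ n := by
  induction n using Nat.twoStepInduction with
  | zero => simp [T]
  | one => simp [T]
  | more n h₁ h₂ =>
    rw [T]
    refine (Polynomial.natDegree_sub_le _ _).trans (max_le ?_ (h₁.trans (by omega)))
    refine Polynomial.natDegree_mul_le.trans ?_
    rw [Polynomial.natDegree_X]
    omega

lemma aeval_free_T_ez {J₀ : HZ →L[ℝ] HZ} (hJ₀ : ∀ k : ℤ, J₀ (ez k) = ez (k - 1) + ez (k + 1))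
    (n : ℕ) (k : ℤ) : aeval J₀ (T n) (ez k) = ez (k - n) + ez (k + n) := by
  induction n using Nat.twoStepInduction with
  | zero =>
    rw [T, aeval_C, Nat.cast_zero, sub_zero, add_zero, Algebra.algebraMap_eq_smul_one,
      smul_apply, one_apply_eq_self, two_smul]
  | one => rw [T, aeval_X, hJ₀, Nat.cast_one]
  | more n h₁ h₂ =>
    rw [T, map_sub, map_mul, aeval_X, sub_apply, mul_apply_eq_comp,
      h₁, h₂, map_add, hJ₀, hJ₀]
    push_cast
    rw [show k - (n + 1 : ℤ) - 1 = k - (n + 2) by ring, show k - (n + 1 : ℤ) + 1 = k - n by ring,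
      show k + (n + 1 : ℤ) - 1 = k + n by ring, show k + (n + 1 : ℤ) + 1 = k + (n + 2) by ring]
    abel

lemma inner_aeval_free_T_ez {J₀ : HZ →L[ℝ] HZ}
    (hJ₀ : ∀ k : ℤ, J₀ (ez k) = ez (k - 1) + ez (k + 1)) {n : ℕ} (hn : n ≠ 0) (k : ℤ) :
    ⟪aeval J₀ (T n) (ez k), ez k⟫ = 0 := by
  rw [aeval_free_T_ez hJ₀, inner_add_left, inner_ez, inner_ez, if_neg (by omega),
    if_neg (by omega), add_zero]

lemma tsum_int_eq_sum_valMinAbs {f : ℤ → ℝ} {R : ℕ} (hf : ∀ k : ℤ, R < |k| → f k = 0) :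
    ∑' k, f k = ∑ i : ZMod (2 * R + 1), f i.valMinAbs := by
  rw [tsum_eq_sum (s := Finset.Icc (-R : ℤ) R)]
  · refine (Finset.sum_bij (fun i _ => i.valMinAbs) ?_ ?_ ?_ fun _ _ => rfl).symm
    · intro i _
      obtain ⟨h1, h2⟩ := ZMod.valMinAbs_mem_Ioc i
      push_cast at h1 h2
      rw [Finset.mem_Icc]
      omega
    · intro i _ j _ h
      exact ZMod.injective_valMinAbs h
    · intro k hk
      rw [Finset.mem_Icc] at hk
      exact ⟨(k : ZMod (2 * R + 1)), Finset.mem_univ _,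
        (ZMod.valMinAbs_spec _ _).2 ⟨rfl, by push_cast; omega, by push_cast; omega⟩⟩
  · intro k hk
    refine hf k ?_
    rw [Finset.mem_Icc, ← abs_le] at hk
    omega

lemma trace_aeval_cyclicJacobi {p q : ℤ → ℝ} {J J₀ : HZ →L[ℝ] HZ}
    (hJ : ∀ k : ℤ, J (ez k) = p k • ez (k - 1) + q k • ez k + p (k + 1) • ez (k + 1))
    (hJ₀ : ∀ k : ℤ, J₀ (ez k) = ez (k - 1) + ez (k + 1)) {K : ℕ}
    (hp : ∀ k : ℤ, K < |k| → p k = 1) (hq : ∀ k : ℤ, K < |k| → q k = 0)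
    {n R : ℕ} (hn : n ≠ 0) (hR : n + K ≤ R) {ω : ℂ} (hω : ω ≠ 0) :
    (aeval (cyclicJacobi (fun i : ZMod (2 * R + 1) => p i.valMinAbs)
        (fun i => q i.valMinAbs) ω) (T n)).trace =
      ((∑' k : ℤ, ⟪(aeval J (T n) - aeval J₀ (T n)) (ez k), ez k⟫ : ℝ) : ℂ) := by
  rw [tsum_int_eq_sum_valMinAbs (R := R), Matrix.trace, Complex.ofReal_sum]
  · refine Finset.sum_congr rfl fun i _ => ?_
    have hi : |i.valMinAbs| ≤ R := by
      obtain ⟨h1, h2⟩ := ZMod.valMinAbs_mem_Ioc i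
      push_cast at h1 h2
      rw [abs_le]
      omega
    have h := aeval_cyclicJacobi_diag hJ
      (P := fun i : ZMod (2 * R + 1) => p i.valMinAbs) (Q := fun i => q i.valMinAbs) (K := K)
      (fun k hk => apply_valMinAbs_eq hp (by omega) hk)
      (fun k hk => apply_valMinAbs_eq hq (by omega) hk) hω (natDegree_T_le n) i.valMinAbs
      (by push_cast; omega)
    rw [ZMod.coe_valMinAbs] at h
    rw [Matrix.diag_apply, h, sub_apply, inner_sub_left,
      inner_aeval_free_T_ez hJ₀ hn, sub_zero]
  · intro k hk
    rw [sub_apply, inner_sub_left, inner_aeval_ez J (natDegree_T_le n),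
      inner_aeval_ez J₀ (natDegree_T_le n), sub_eq_zero]
    refine Finset.sum_congr rfl fun i hi => ?_
    rw [Finset.mem_range] at hi
    rw [inner_pow_ez_eq_free hJ hJ₀ hp hq i k k (by omega)]

/-- The coefficient of `x n` in `∑ k l, c k * c l * (x (k + l) - x |k - l|)`. -/
def hankelToeplitzCoeff (c : ℕ → ℝ) (d n : ℕ) : ℝ :=
  ∑ k ∈ Finset.range (d + 1), ∑ l ∈ Finset.range (d + 1), c k * c l *
    ((if k + l = n then 1 else 0) - (if ((k : ℤ) - l).natAbs = n then 1 else 0))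

lemma hankelToeplitzCoeff_eq_zero (c : ℕ → ℝ) {d n : ℕ} (hn : 2 * d < n) :
    hankelToeplitzCoeff c d n = 0 := by
  refine Finset.sum_eq_zero fun k hk => Finset.sum_eq_zero fun l hl => ?_
  rw [Finset.mem_range] at hk hl
  rw [if_neg (by omega), if_neg (by omega), sub_zero, mul_zero]

lemma sum_hankelToeplitzCoeff_mul (c x : ℕ → ℝ) (d : ℕ) :
    ∑ n ∈ Finset.range (2 * d + 1), hankelToeplitzCoeff c d n * x n =
      ∑ k ∈ Finset.range (d + 1), ∑ l ∈ Finset.range (d + 1),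
        c k * c l * (x (k + l) - x ((k : ℤ) - l).natAbs) := by
  simp_rw [hankelToeplitzCoeff, Finset.sum_mul]
  rw [Finset.sum_comm]
  refine Finset.sum_congr rfl fun k hk => ?_
  rw [Finset.sum_comm]
  refine Finset.sum_congr rfl fun l hl => ?_
  rw [Finset.mem_range] at hk hl
  simp_rw [mul_assoc, ← Finset.mul_sum, sub_mul, Finset.sum_sub_distrib, ite_mul, one_mul, zero_mul,
    Finset.sum_ite_eq]
  rw [if_pos (Finset.mem_range.2 (by omega)), if_pos (Finset.mem_range.2 (by omega))]

lemma sum_hankelToeplitzCoeff_mul_of_rankOne (c x y : ℕ → ℝ) (d : ℕ) {r : ℝ}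
    (hx : ∀ k l : ℕ, x (k + l) - x ((k : ℤ) - l).natAbs = r * (y k * y l)) :
    ∑ n ∈ Finset.range (2 * d + 1), hankelToeplitzCoeff c d n * x n =
      r * (∑ k ∈ Finset.range (d + 1), c k * y k) ^ 2 := by
  rw [sum_hankelToeplitzCoeff_mul, sq, Finset.sum_mul_sum, Finset.mul_sum]
  refine Finset.sum_congr rfl fun k _ => ?_
  rw [Finset.mul_sum]
  refine Finset.sum_congr rfl fun l _ => ?_
  rw [hx]
  ring

lemma sum_hankelToeplitzCoeff_mul_cos (c : ℕ → ℝ) (d : ℕ) (θ : ℝ) :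
    ∑ n ∈ Finset.range (2 * d + 1), hankelToeplitzCoeff c d n * Real.cos (n * θ) ≤ 0 := by
  rw [sum_hankelToeplitzCoeff_mul_of_rankOne c (fun n => Real.cos (n * θ))
    (fun k => Real.sin (k * θ)) d (r := -2)]
  · exact mul_nonpos_of_nonpos_of_nonneg (by norm_num) (sq_nonneg _)
  · intro k l
    have h : Real.cos (((k : ℤ) - l).natAbs * θ) = Real.cos (k * θ - l * θ) := by
      rw [Nat.cast_natAbs]
      push_cast
      rcases abs_cases ((k : ℝ) - l) with h | h
      · rw [h.1, sub_mul]
      · rw [h.1, neg_mul, Real.cos_neg, sub_mul]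
    simp only [h, Nat.cast_add, add_mul, Real.cos_add, Real.cos_sub]
    ring

lemma sum_hankelToeplitzCoeff_mul_cosh (c : ℕ → ℝ) (d : ℕ) {σ : ℝ} (hσ : σ = 1 ∨ σ = -1)
    (t : ℝ) :
    0 ≤ ∑ n ∈ Finset.range (2 * d + 1),
      hankelToeplitzCoeff c d n * (σ ^ n * Real.cosh (n * t)) := by
  rw [sum_hankelToeplitzCoeff_mul_of_rankOne c (fun n => σ ^ n * Real.cosh (n * t))
    (fun k => σ ^ k * Real.sinh (k * t)) d (r := 2)]
  · positivity
  · intro k l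
    have h : Real.cosh (((k : ℤ) - l).natAbs * t) = Real.cosh (k * t - l * t) := by
      rw [Nat.cast_natAbs]
      push_cast
      rcases abs_cases ((k : ℝ) - l) with h | h
      · rw [h.1, sub_mul]
      · rw [h.1, neg_mul, Real.cosh_neg, sub_mul]
    have hpow : σ ^ ((k : ℤ) - l).natAbs = σ ^ (k + l) := by
      rcases hσ with rfl | rfl
      · simp
      · refine neg_one_pow_congr ?_
        rw [Int.natAbs_even, Int.even_sub, Nat.even_add, Int.even_coe_nat, Int.even_coe_nat]
    simp only [h, hpow, Nat.cast_add, add_mul, Real.cosh_add, Real.cosh_sub, pow_add]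
    ring

lemma exists_nat_forall_lt_abs {s : Set ℤ} (hs : s.Finite) : ∃ K : ℕ, ∀ k : ℤ, K < |k| → k ∉ s := by
  obtain ⟨K, hK⟩ := (hs.image Int.natAbs).bddAbove
  refine ⟨K, fun k hk hks => ?_⟩
  have := hK (Set.mem_image_of_mem _ hks)
  rw [Int.abs_eq_natAbs] at hk
  omega

/-- The matrix `(a_{k+l}(J) - a_{|k-l|}(J))_{k,l ≥ 1}` is positive semidefinite. -/
theorem stmt_10
    (p q : ℤ → ℝ) (hp : ∀ k, 0 < p k)
    (hfp : {k : ℤ | p k ≠ 1}.Finite) (hfq : {k : ℤ | q k ≠ 0}.Finite)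
    (J J₀ : HZ →L[ℝ] HZ)
    (hJ : ∀ k : ℤ, J (ez k) = p k • ez (k - 1) + q k • ez k + p (k + 1) • ez (k + 1))
    (hJ₀ : ∀ k : ℤ, J₀ (ez k) = ez (k - 1) + ez (k + 1))
    (a : ℕ → ℝ)
    (ha0 : a 0 = ∑' k : ℤ, Real.log (p k ^ 2))
    (haj : ∀ j : ℕ, 1 ≤ j →
      a j = (1 / (j : ℝ)) * ∑' k : ℤ, ⟪(aeval J (T j) - aeval J₀ (T j)) (ez k), ez k⟫)
    (c : ℕ → ℝ) (hcfin : (Function.support c).Finite) (hc0 : c 0 = 0) :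
    0 ≤ ∑' kl : ℕ × ℕ,
      (a (kl.1 + kl.2) - a ((kl.1 : ℤ) - (kl.2 : ℤ)).natAbs) * c kl.1 * c kl.2 := by
  obtain ⟨K₁, hK₁⟩ := exists_nat_forall_lt_abs hfp
  obtain ⟨K₂, hK₂⟩ := exists_nat_forall_lt_abs hfq
  set K := max K₁ K₂
  have hp1 : ∀ k : ℤ, K < |k| → p k = 1 := fun k hk => not_not.1 (hK₁ k (by omega))
  have hq0 : ∀ k : ℤ, K < |k| → q k = 0 := fun k hk => not_not.1 (hK₂ k (by omega))
  obtain ⟨d, hd⟩ := hcfin.bddAbove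
  have hcd : ∀ k, d < k → c k = 0 := fun k hk => by
    by_contra h
    exact absurd (hd h) (not_le.2 hk)
  set R := 2 * d + K
  have h := cyclic_sum_rule (fun n hn => hankelToeplitzCoeff_eq_zero c hn)
    (sum_hankelToeplitzCoeff_mul_cos c d)
    (fun σ hσ t => sum_hankelToeplitzCoeff_mul_cosh c d hσ t)
    (P := fun i : ZMod (2 * R + 1) => p i.valMinAbs) (Q := fun i => q i.valMinAbs)
    (fun i => hp _) (τ := fun n => ∑' k : ℤ, ⟪(aeval J (T n) - aeval J₀ (T n)) (ez k), ez k⟫)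
    (fun ω hω n hn => by
      rw [Finset.mem_Icc] at hn
      exact trace_aeval_cyclicJacobi hJ hJ₀ hp1 hq0 (by omega) (by omega)
        (norm_ne_zero_iff.1 (by rw [hω]; exact one_ne_zero)))
  have ha : 2 * Real.log (∏ i : ZMod (2 * R + 1), p i.valMinAbs) = a 0 := by
    rw [ha0, tsum_int_eq_sum_valMinAbs (R := R), Real.log_prod (fun i _ => (hp _).ne'),
      Finset.mul_sum]
    · simp [Real.log_pow]
    · intro k hk
      rw [hp1 k (by omega), one_pow, Real.log_one]
  have hsum : ∑' kl : ℕ × ℕ,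
      (a (kl.1 + kl.2) - a ((kl.1 : ℤ) - (kl.2 : ℤ)).natAbs) * c kl.1 * c kl.2 =
      ∑ n ∈ Finset.range (2 * d + 1), hankelToeplitzCoeff c d n * a n := by
    rw [sum_hankelToeplitzCoeff_mul,
      tsum_eq_sum (s := Finset.range (d + 1) ×ˢ Finset.range (d + 1)), Finset.sum_product]
    · refine Finset.sum_congr rfl fun k _ => Finset.sum_congr rfl fun l _ => ?_
      ring
    · rintro ⟨k, l⟩ hkl
      rw [Finset.mem_product, Finset.mem_range, Finset.mem_range, not_and_or] at hkl
      rcases hkl with hk | hl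
      · simp [hcd k (by omega)]
      · simp [hcd l (by omega)]
  rw [hsum, Finset.range_eq_Ico, Finset.sum_eq_sum_Ico_succ_bot (by omega), ← ha]
  convert h using 2
  refine Finset.sum_congr rfl fun n hn => ?_
  rw [Finset.mem_Icc] at hn
  rw [haj n hn.1]
  ring

end
end

section
/- For every integer n ≥ 1, the operator T_n(J) − T_n(J₀) is Hilbert–Schmidt if and only if the following four sequences, indexed by j ∈ ℤ, are square-summable: ( Σ_{k=1}^{n} u_{j+k} )_j, ( Σ_{k=1}^{n} q_{j+k} )_j, ( u_j² )_j, and ( q_j² )_j, where u_j := p_j² − 1. -/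
open Polynomial
open scoped ENNReal RealInnerProductSpace

noncomputable section

/-! ### Square-summable sequences -/

/-- A real sequence indexed by `ℤ` is square-summable. -/
def SqSummable (f : ℤ → ℝ) : Prop := Summable fun j => f j ^ 2

namespace SqSummable

variable {f g : ℤ → ℝ}

theorem of_le (hg : SqSummable g) (C : ℝ) (h : ∀ j, |f j| ≤ C * |g j|) : SqSummable f := by
  refine Summable.of_nonneg_of_le (fun j => sq_nonneg _) (fun j => ?_) (hg.mul_left (C ^ 2))
  have h1 := pow_le_pow_left₀ (abs_nonneg _) (h j) 2
  rwa [mul_pow, sq_abs, sq_abs] at h1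

theorem congr (hg : SqSummable g) (h : ∀ j, f j = g j) : SqSummable f :=
  (funext h : f = g) ▸ hg

theorem zero : SqSummable fun _ => 0 := by simp [SqSummable]

theorem add (hf : SqSummable f) (hg : SqSummable g) : SqSummable fun j => f j + g j := by
  refine Summable.of_nonneg_of_le (fun j => sq_nonneg _) (fun j => ?_)
    ((hf.mul_left 2).add (hg.mul_left 2))
  nlinarith [sq_nonneg (f j - g j)]

theorem mul_bdd (hf : SqSummable f) {C : ℝ} (hg : ∀ j, |g j| ≤ C) :
    SqSummable fun j => g j * f j :=
  hf.of_le C fun j => by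
    rw [abs_mul]
    exact mul_le_mul_of_nonneg_right (hg j) (abs_nonneg _)

theorem const_mul (hf : SqSummable f) (c : ℝ) : SqSummable fun j => c * f j :=
  hf.mul_bdd (g := fun _ => c) (fun _ => le_rfl)

theorem sub (hf : SqSummable f) (hg : SqSummable g) : SqSummable fun j => f j - g j :=
  (hf.add (hg.const_mul (-1))).congr fun j => by ring

theorem sum (n : ℕ) {F : ℕ → ℤ → ℝ} (h : ∀ i, SqSummable (F i)) :
    SqSummable fun j => ∑ i ∈ Finset.range n, F i j := by
  induction n with
  | zero => simpa using zero
  | succ n ih => simpa only [Finset.sum_range_succ] using ih.add (h n)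

theorem shift (hf : SqSummable f) (s : ℤ) : SqSummable fun j => f (j + s) :=
  (Equiv.addRight s).summable_iff (f := fun j => f j ^ 2) |>.2 hf

theorem sq_of_bdd (hf : SqSummable f) {C : ℝ} (hC : ∀ j, |f j| ≤ C) :
    SqSummable fun j => f j ^ 2 :=
  (hf.mul_bdd hC).congr fun j => sq (f j)

/-- The product of two sequences in `ℓ⁴` is in `ℓ²`. -/
theorem mul_of_sq (hf : SqSummable fun j => f j ^ 2) (hg : SqSummable fun j => g j ^ 2) :
    SqSummable fun j => f j * g j :=
  (hf.add hg).of_le 1 fun j => by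
    rw [one_mul, abs_of_nonneg (by positivity : 0 ≤ f j ^ 2 + g j ^ 2), abs_le]
    constructor <;> nlinarith [sq_nonneg (f j + g j), sq_nonneg (f j - g j), sq_nonneg (f j),
      sq_nonneg (g j)]

theorem sq_add (hf : SqSummable fun j => f j ^ 2) (hg : SqSummable fun j => g j ^ 2) :
    SqSummable fun j => (f j + g j) ^ 2 :=
  ((hf.add hg).add ((mul_of_sq hf hg).const_mul 2)).congr fun j => by ring

theorem sq_sum (n : ℕ) {F : ℕ → ℤ → ℝ} (h : ∀ i, SqSummable fun j => F i j ^ 2) :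
    SqSummable fun j => (∑ i ∈ Finset.range n, F i j) ^ 2 := by
  induction n with
  | zero => simpa using zero
  | succ n ih => simpa only [Finset.sum_range_succ] using sq_add ih (h n)

/-- A positive sequence that differs from `1` by a square-summable one is bounded below. -/
theorem exists_pos_le (hf : SqSummable fun j => f j - 1) (hpos : ∀ j, 0 < f j) :
    ∃ ε, 0 < ε ∧ ∀ j, ε ≤ f j := by
  have h : ∀ᶠ j in Filter.cofinite, (f j - 1) ^ 2 < 1 / 4 :=
    (Summable.tendsto_cofinite_zero hf).eventually_lt_const (by norm_num)
  have hfin : {j | ¬ (f j - 1) ^ 2 < 1 / 4}.Finite := h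
  obtain ⟨δ, hδ, hδf⟩ : ∃ δ, 0 < δ ∧ ∀ j ∈ {j | ¬ (f j - 1) ^ 2 < 1 / 4}, δ ≤ f j := by
    rcases Set.eq_empty_or_nonempty {j | ¬ (f j - 1) ^ 2 < 1 / 4} with he | hne
    · exact ⟨1, one_pos, by rw [he]; simp⟩
    · obtain ⟨j₀, -, hj₀⟩ := Set.exists_min_image _ f hfin hne
      exact ⟨f j₀, hpos _, hj₀⟩
  refine ⟨min δ (1 / 2), by positivity, fun j => ?_⟩
  by_cases hj : (f j - 1) ^ 2 < 1 / 4
  · exact (min_le_right _ _).trans (by nlinarith)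
  · exact (min_le_left _ _).trans (hδf j hj)

theorem log (hf : SqSummable fun j => f j - 1) (hpos : ∀ j, 0 < f j) :
    SqSummable fun j => Real.log (f j) := by
  obtain ⟨ε, hε, hεf⟩ := hf.exists_pos_le hpos
  refine hf.of_le (1 + ε⁻¹) fun j => ?_
  have h1 := Real.log_le_sub_one_of_pos (hpos j)
  have h2 := Real.one_sub_inv_le_log_of_pos (hpos j)
  have h3 : (f j)⁻¹ ≤ ε⁻¹ := inv_anti₀ hε (hεf j)
  have h4 : 1 - (f j)⁻¹ = (f j)⁻¹ * (f j - 1) := by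
    have := (hpos j).ne'
    field_simp
  have h5 : 0 < (f j)⁻¹ := inv_pos.2 (hpos j)
  have h6 : (f j)⁻¹ * |f j - 1| ≤ ε⁻¹ * |f j - 1| :=
    mul_le_mul_of_nonneg_right h3 (abs_nonneg _)
  have h7 : -((f j)⁻¹ * |f j - 1|) ≤ (f j)⁻¹ * (f j - 1) := by
    nlinarith [neg_abs_le (f j - 1)]
  have h8 := abs_nonneg (f j - 1)
  have h9 := le_abs_self (f j - 1)
  have h10 : 0 ≤ (f j)⁻¹ * |f j - 1| := by positivity
  rw [abs_le, add_mul, one_mul]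
  constructor <;> linarith

end SqSummable

/-! ### Matrix entries of Chebyshev polynomials of a Jacobi matrix -/

/-- The matrix entry of `T_n(J)` at row and column `j + m`, `j`. -/
def chebEntry (p q : ℤ → ℝ) : ℕ → ℤ → ℤ → ℝ
  | 0, m, _ => if m = 0 then 2 else 0
  | 1, m, j => if m = 1 then p (j + 1) else if m = 0 then q j else if m = -1 then p j else 0
  | n + 2, m, j => p (j + m) * chebEntry p q (n + 1) (m - 1) j
      + q (j + m) * chebEntry p q (n + 1) m j
      + p (j + m + 1) * chebEntry p q (n + 1) (m + 1) j - chebEntry p q n m j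

/-- The matrix entry of `T_n(J₀)` at row and column `j + m`, `j`. -/
def freeEntry (n : ℕ) (m : ℤ) : ℝ := (if m = n then 1 else 0) + (if m = -n then 1 else 0)

theorem freeEntry_add_two (n : ℕ) (m : ℤ) :
    freeEntry (n + 2) m = freeEntry (n + 1) (m - 1) + freeEntry (n + 1) (m + 1)
      - freeEntry n m := by
  have e1 : (m - 1 = ((n + 1 : ℕ) : ℤ)) ↔ m = ((n + 2 : ℕ) : ℤ) := by grind
  have e2 : (m + 1 = ((n + 1 : ℕ) : ℤ)) ↔ m = (n : ℤ) := by grind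
  have e3 : (m - 1 = -((n + 1 : ℕ) : ℤ)) ↔ m = -(n : ℤ) := by grind
  have e4 : (m + 1 = -((n + 1 : ℕ) : ℤ)) ↔ m = -((n + 2 : ℕ) : ℤ) := by grind
  simp only [freeEntry, e1, e2, e3, e4]
  ring

theorem chebEntry_free (n : ℕ) (m j : ℤ) :
    chebEntry (fun _ => 1) (fun _ => 0) n m j = freeEntry n m := by
  induction n using Nat.twoStepInduction generalizing m with
  | zero =>
    simp only [chebEntry, freeEntry]
    split_ifs <;> grind
  | one =>
    simp only [chebEntry, freeEntry]
    split_ifs <;> grind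
  | more n ih ih' =>
    rw [chebEntry, ih, ih' (m - 1), ih' m, ih' (m + 1), freeEntry_add_two]
    ring

theorem chebEntry_eq_zero (p q : ℤ → ℝ) (n : ℕ) (m j : ℤ) (h : (n : ℤ) < |m|) :
    chebEntry p q n m j = 0 := by
  induction n using Nat.twoStepInduction generalizing m with
  | zero => grind [chebEntry]
  | one => grind [chebEntry]
  | more n ih ih' =>
    rw [chebEntry, ih m (by grind), ih' m (by grind), ih' (m - 1) (by grind),
      ih' (m + 1) (by grind)]
    ring

theorem inner_ez_ez (i k : ℤ) : ⟪ez i, ez k⟫ = if i = k then (1 : ℝ) else 0 := by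
  rw [ez, ez, lp.inner_single_left]
  by_cases h : i = k
  · subst h; simp
  · simp [h]

theorem inner_aeval_T (p q : ℤ → ℝ) (J : HZ →L[ℝ] HZ)
    (hJ : ∀ k : ℤ, J (ez k) = p k • ez (k - 1) + q k • ez k + p (k + 1) • ez (k + 1))
    (n : ℕ) (m j : ℤ) :
    ⟪aeval J (T n) (ez (j + m)), ez j⟫ = chebEntry p q n m j := by
  induction n using Nat.twoStepInduction generalizing m with
  | zero =>
    have : aeval J (T 0) (ez (j + m)) = (2 : ℝ) • ez (j + m) := by
      rw [T, aeval_C]; rfl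
    rw [this, real_inner_smul_left, inner_ez_ez, chebEntry]
    simp
  | one =>
    rw [T, aeval_X, hJ]
    have e1 : j + m - 1 = j ↔ m = 1 := by omega
    have e2 : j + m = j ↔ m = 0 := by omega
    have e3 : j + m + 1 = j ↔ m = -1 := by omega
    simp only [inner_add_left, real_inner_smul_left, inner_ez_ez, chebEntry, e1, e2, e3]
    by_cases h1 : m = 1
    · simp [h1]
    · by_cases h0 : m = 0
      · simp [h0]
      · by_cases h2 : m = -1
        · simp [h2]
        · simp [h0, h1, h2]
  | more n ih ih' =>
    have : aeval J (T (n + 2)) (ez (j + m))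
        = aeval J (T (n + 1)) (J (ez (j + m))) - aeval J (T n) (ez (j + m)) := by
      rw [show T (n + 2) = T (n + 1) * X - T n by rw [T, mul_comm], map_sub, map_mul, aeval_X,
        sub_apply, mul_apply_eq_comp]
    rw [this, hJ]
    simp only [inner_add_left, inner_sub_left, map_add, map_smul, real_inner_smul_left]
    rw [ih, ih', add_assoc j m 1, ih', add_sub_assoc j m 1, ih', chebEntry, add_assoc j m 1]

/-- The Hilbert–Schmidt property of `T_n(J) - T_n(J₀)`, diagonal by diagonal. -/
theorem summable_inner_iff (p q : ℤ → ℝ) (J J₀ : HZ →L[ℝ] HZ)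
    (hJ : ∀ k : ℤ, J (ez k) = p k • ez (k - 1) + q k • ez k + p (k + 1) • ez (k + 1))
    (hJ₀ : ∀ k : ℤ, J₀ (ez k) = ez (k - 1) + ez (k + 1)) (n : ℕ) :
    Summable (fun ij : ℤ × ℤ => ⟪(aeval J (T n) - aeval J₀ (T n)) (ez ij.1), ez ij.2⟫ ^ 2)
      ↔ ∀ m, SqSummable fun j => chebEntry p q n m j - freeEntry n m := by
  let e : ℤ × ℤ ≃ ℤ × ℤ :=
    { toFun := fun x => (x.2 + x.1, x.2)
      invFun := fun x => (x.1 - x.2, x.2)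
      left_inv := fun x => by simp
      right_inv := fun x => by simp }
  have key : ∀ m j, ⟪(aeval J (T n) - aeval J₀ (T n)) (ez (j + m)), ez j⟫
      = chebEntry p q n m j - freeEntry n m := fun m j => by
    rw [sub_apply, inner_sub_left, inner_aeval_T p q J hJ,
      inner_aeval_T (fun _ => 1) (fun _ => 0) J₀ (fun k => by rw [hJ₀]; simp), chebEntry_free]
  rw [← e.summable_iff]
  have hfun : (fun ij : ℤ × ℤ =>
      ⟪(aeval J (T n) - aeval J₀ (T n)) (ez ij.1), ez ij.2⟫ ^ 2) ∘ e
      = fun x => (chebEntry p q n x.1 x.2 - freeEntry n x.1) ^ 2 :=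
    funext fun x => by simp only [Function.comp, e, Equiv.coe_fn_mk, key]
  rw [hfun, summable_prod_of_nonneg (fun x => sq_nonneg _)]
  refine and_iff_left_of_imp fun _ => summable_of_hasFiniteSupport ?_
  refine (Set.finite_Icc (-(n : ℤ)) n).subset fun m hm => ?_
  by_contra hm'
  have hlt : (n : ℤ) < |m| := by
    rw [Set.mem_Icc] at hm'
    grind
  apply hm
  have h0 : freeEntry n m = 0 := by
    rw [← chebEntry_free n m 0]
    exact chebEntry_eq_zero _ _ n m 0 hlt
  simp [chebEntry_eq_zero p q n m _ hlt, h0]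

/-! ### Sums over blocks of consecutive indices -/

/-- The sum of `n` consecutive terms of `f` starting at `s`. -/
def blockSum (f : ℤ → ℝ) (n : ℕ) (s : ℤ) : ℝ := ∑ i ∈ Finset.range n, f (s + i)

theorem blockSum_succ (f : ℤ → ℝ) (n : ℕ) (s : ℤ) :
    blockSum f (n + 1) s = blockSum f n s + f (s + n) :=
  Finset.sum_range_succ _ _

theorem blockSum_succ' (f : ℤ → ℝ) (n : ℕ) (s : ℤ) :
    blockSum f (n + 1) s = blockSum f n (s + 1) + f s := by
  rw [blockSum, Finset.sum_range_succ']
  simp only [blockSum, Nat.cast_add, Nat.cast_one, Nat.cast_zero, add_zero]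
  congr 1
  exact Finset.sum_congr rfl fun i _ => by congr 1; ring

theorem sum_Icc_eq_blockSum (f : ℤ → ℝ) (n : ℕ) (j : ℤ) :
    ∑ k ∈ Finset.Icc 1 (n : ℤ), f (j + k) = blockSum f n (j + 1) := by
  symm
  refine Finset.sum_nbij (fun i : ℕ => (i : ℤ) + 1) ?_ ?_ ?_ ?_
  · intro i hi
    simp only [Finset.mem_range] at hi
    simp only [Finset.mem_Icc]
    omega
  · intro a _ b _ h
    simpa using h
  · intro k hk
    simp only [Finset.coe_Icc, Set.mem_Icc] at hk
    refine ⟨(k - 1).toNat, ?_, ?_⟩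
    · simp only [Finset.coe_range, Set.mem_Iio]
      omega
    · simp only
      omega
  · intro i _
    congr 1
    ring

theorem SqSummable.sum_Icc_iff (f : ℤ → ℝ) (n : ℕ) :
    Summable (fun j : ℤ => (∑ k ∈ Finset.Icc 1 (n : ℤ), f (j + k)) ^ 2)
      ↔ SqSummable (blockSum f n) := by
  simp only [sum_Icc_eq_blockSum]
  refine ⟨fun h => ?_, fun h => h.shift 1⟩
  have h' : SqSummable fun j => blockSum f n (j + 1) := h
  exact (h'.shift (-1)).congr fun j => by simp

/-! ### The linear part of the entries -/

/-- The coefficient on the `m`-th diagonal of the derivative of `T_n` at `J₀` in the direction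
of the diagonal matrix with entries `f`. -/
def linDiag (f : ℤ → ℝ) (n : ℕ) (m j : ℤ) : ℝ :=
  if ((n : ℤ) - 1 - m) % 2 = 0 ∧ -(n : ℤ) < m ∧ m < n then
    blockSum f n (j - ((n : ℤ) - 1 - m) / 2) else 0

theorem linDiag_add_two (f : ℤ → ℝ) (n : ℕ) (m j : ℤ) :
    linDiag f (n + 2) m j = linDiag f (n + 1) (m - 1) j + linDiag f (n + 1) (m + 1) j
      - linDiag f n m j + f (j + m) * freeEntry (n + 1) m := by
  rcases Int.even_or_odd' ((n : ℤ) + 1 - m) with ⟨k, hk | hk⟩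
  · obtain rfl : m = n + 1 - 2 * k := by omega
    have e1 : j - (((n + 2 : ℕ) : ℤ) - 1 - (n + 1 - 2 * k)) / 2 = j - k := by
      push_cast; omega
    have e2 : j - (((n + 1 : ℕ) : ℤ) - 1 - (n + 1 - 2 * k - 1)) / 2 = j - k := by
      push_cast; omega
    have e3 : j - (((n + 1 : ℕ) : ℤ) - 1 - (n + 1 - 2 * k + 1)) / 2 = j - k + 1 := by
      push_cast; omega
    have e4 : j - ((n : ℤ) - 1 - (n + 1 - 2 * k)) / 2 = j - k + 1 := by omega
    have c1 : ((((n + 2 : ℕ) : ℤ) - 1 - (n + 1 - 2 * k)) % 2 = 0 ∧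
        -((n + 2 : ℕ) : ℤ) < n + 1 - 2 * k ∧ (n + 1 - 2 * k : ℤ) < (n + 2 : ℕ)) ↔
        0 ≤ k ∧ k ≤ n + 1 := by push_cast; omega
    have c2 : ((((n + 1 : ℕ) : ℤ) - 1 - (n + 1 - 2 * k - 1)) % 2 = 0 ∧
        -((n + 1 : ℕ) : ℤ) < n + 1 - 2 * k - 1 ∧ (n + 1 - 2 * k - 1 : ℤ) < (n + 1 : ℕ)) ↔
        0 ≤ k ∧ k ≤ n := by push_cast; omega
    have c3 : ((((n + 1 : ℕ) : ℤ) - 1 - (n + 1 - 2 * k + 1)) % 2 = 0 ∧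
        -((n + 1 : ℕ) : ℤ) < n + 1 - 2 * k + 1 ∧ (n + 1 - 2 * k + 1 : ℤ) < (n + 1 : ℕ)) ↔
        1 ≤ k ∧ k ≤ n + 1 := by push_cast; omega
    have c4 : (((n : ℤ) - 1 - (n + 1 - 2 * k)) % 2 = 0 ∧
        -(n : ℤ) < n + 1 - 2 * k ∧ (n + 1 - 2 * k : ℤ) < n) ↔
        1 ≤ k ∧ k ≤ n := by omega
    have c5 : ((n : ℤ) + 1 - 2 * k = ((n + 1 : ℕ) : ℤ)) ↔ k = 0 := by push_cast; omega
    have c6 : ((n : ℤ) + 1 - 2 * k = -((n + 1 : ℕ) : ℤ)) ↔ k = n + 1 := by push_cast; omega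
    simp only [linDiag, freeEntry, c1, c2, c3, c4, c5, c6, e1, e2, e3, e4]
    have b1 := blockSum_succ f (n + 1) (j - k)
    have b2 := blockSum_succ' f (n + 1) (j - k)
    have b3 := blockSum_succ' f n (j - k)
    have a0 : k = 0 → f (j + (n + 1 - 2 * k)) = f (j - k + (n + 1 : ℕ)) := by
      rintro rfl; congr 1; push_cast; ring
    have a1 : k = n + 1 → f (j + (n + 1 - 2 * k)) = f (j - k) := by
      rintro rfl; congr 1; ring
    by_cases h0 : k = 0
    · rw [a0 h0, b1]
      have : ¬ k = (n : ℤ) + 1 := by omega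
      rw [if_pos (by omega), if_pos (by omega), if_neg (by omega), if_neg (by omega), if_pos h0,
        if_neg this]
      ring
    · by_cases h1 : k = n + 1
      · rw [a1 h1, b2, if_pos (by omega), if_neg (by omega), if_pos (by omega),
          if_neg (by omega), if_neg h0, if_pos h1]
        ring
      · rw [if_neg h0, if_neg h1]
        by_cases h2 : 1 ≤ k ∧ k ≤ n
        · rw [if_pos (by omega), if_pos (by omega), if_pos (by omega), if_pos h2]
          linear_combination b2 - b3
        · rw [if_neg (by omega), if_neg (by omega), if_neg (by omega), if_neg h2]
          ring
  · simp only [linDiag, freeEntry]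
    rw [if_neg (by omega), if_neg (by omega), if_neg (by omega), if_neg (by omega),
      if_neg (by omega), if_neg (by omega)]
    ring

theorem SqSummable.sq_linDiag {f : ℤ → ℝ} (hf : SqSummable fun j => f j ^ 2) (n : ℕ) (m : ℤ) :
    SqSummable fun j => linDiag f n m j ^ 2 := by
  unfold linDiag
  split_ifs
  · exact sq_sum n fun i => (hf.shift (i - ((n : ℤ) - 1 - m) / 2)).congr fun j => by
      congr 2; ring
  · simpa using zero

theorem SqSummable.linDiag {f : ℤ → ℝ} {n : ℕ} (hf : SqSummable (blockSum f n)) (m : ℤ) :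
    SqSummable fun j => linDiag f n m j := by
  unfold _root_.linDiag
  split_ifs
  · exact hf.shift (-(((n : ℤ) - 1 - m) / 2))
  · exact zero

/-- The coefficient on the `m`-th diagonal of the derivative of `T_n` at `J₀` in the direction
of the Jacobi matrix with entries `a`, `q`. -/
def linPart (a q : ℤ → ℝ) (n : ℕ) (m j : ℤ) : ℝ :=
  linDiag q n m j + linDiag a n (m - 1) (j + 1) + linDiag a n (m + 1) j

theorem linPart_add_two (a q : ℤ → ℝ) (n : ℕ) (m j : ℤ) :
    linPart a q (n + 2) m j = linPart a q (n + 1) (m - 1) j + linPart a q (n + 1) (m + 1) j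
      - linPart a q n m j + q (j + m) * freeEntry (n + 1) m
      + a (j + m) * freeEntry (n + 1) (m - 1) + a (j + m + 1) * freeEntry (n + 1) (m + 1) := by
  have h1 := linDiag_add_two q n m j
  have h2 := linDiag_add_two a n (m - 1) (j + 1)
  have h3 := linDiag_add_two a n (m + 1) j
  rw [show j + 1 + (m - 1) = j + m by ring] at h2
  rw [← add_assoc j m 1] at h3
  simp only [linPart, add_sub_cancel_right, sub_add_cancel] at *
  linear_combination h1 + h2 + h3

/-- Up to a square-summable error, the entries of `T_n(J)` are given by the first order Taylor
expansion at `J₀` if `p - 1` and `q` are in `ℓ⁴`. -/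
theorem sqSummable_chebEntry_sub (p q : ℤ → ℝ) {C D : ℝ} (hC : ∀ k, |p k| ≤ C)
    (hD : ∀ k, |q k| ≤ D) (ha : SqSummable fun j => (p j - 1) ^ 2)
    (hq : SqSummable fun j => q j ^ 2) (n : ℕ) (m : ℤ) :
    SqSummable fun j =>
      chebEntry p q n m j - freeEntry n m - linPart (fun k => p k - 1) q n m j := by
  set a : ℤ → ℝ := fun k => p k - 1 with ha_def
  have hlin : ∀ n m, SqSummable fun j => linPart a q n m j ^ 2 := fun n m =>
    SqSummable.sq_add (SqSummable.sq_add (hq.sq_linDiag n m)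
      ((SqSummable.sq_linDiag ha n (m - 1)).shift 1)) (SqSummable.sq_linDiag ha n (m + 1))
  induction n using Nat.twoStepInduction generalizing m with
  | zero =>
    refine SqSummable.zero.congr fun j => ?_
    have h : ∀ f m j, linDiag f 0 m j = 0 := fun f m j => by simp [linDiag, blockSum]
    simp only [chebEntry, freeEntry, linPart, h]
    split_ifs <;> grind
  | one =>
    refine SqSummable.zero.congr fun j => ?_
    have h : ∀ f m j, linDiag f 1 m j = if m = 0 then f j else 0 := fun f m j => by
      by_cases hm : m = 0
      · subst hm; simp [linDiag, blockSum]
      · rw [linDiag, if_neg (by omega), if_neg hm]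
    simp only [chebEntry, freeEntry, linPart, h, ha_def]
    split_ifs <;> grind
  | more n ih ih' =>
    have s1 := (ih' (m - 1)).mul_bdd (fun j => hC (j + m))
    have s2 := (ih' m).mul_bdd (fun j => hD (j + m))
    have s3 := (ih' (m + 1)).mul_bdd (fun j => hC (j + m + 1))
    have t1 := SqSummable.mul_of_sq (SqSummable.shift ha m) (hlin (n + 1) (m - 1))
    have t2 := SqSummable.mul_of_sq (hq.shift m) (hlin (n + 1) m)
    have t3 := SqSummable.mul_of_sq (SqSummable.shift ha (m + 1)) (hlin (n + 1) (m + 1))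
    refine ((((((s1.add s2).add s3).add t1).add t2).add t3).sub (ih m)).congr fun j => ?_
    rw [chebEntry, freeEntry_add_two, linPart_add_two, ← add_assoc]
    simp only [ha_def]
    ring

/-! ### The three outermost diagonals -/

/-- The product of `n` consecutive terms of `p` starting at `s`. -/
def blockProd (p : ℤ → ℝ) (n : ℕ) (s : ℤ) : ℝ := ∏ i ∈ Finset.range n, p (s + i)

theorem blockProd_succ (p : ℤ → ℝ) (n : ℕ) (s : ℤ) :
    blockProd p (n + 1) s = blockProd p n s * p (s + n) :=
  Finset.prod_range_succ _ _

theorem blockProd_pos {p : ℤ → ℝ} (hp : ∀ k, 0 < p k) (n : ℕ) (s : ℤ) : 0 < blockProd p n s :=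
  Finset.prod_pos fun _ _ => hp _

theorem log_blockProd {p : ℤ → ℝ} (hp : ∀ k, 0 < p k) (n : ℕ) (s : ℤ) :
    Real.log (blockProd p n s) = blockSum (fun k => Real.log (p k)) n s :=
  Real.log_prod fun _ _ => (hp _).ne'

theorem chebEntry_diag (p q : ℤ → ℝ) (n : ℕ) (j : ℤ) :
    chebEntry p q (n + 1) (n + 1) j = blockProd p (n + 1) (j + 1) := by
  induction n with
  | zero => simp [chebEntry, blockProd]
  | succ n ih =>
    have z0 := chebEntry_eq_zero p q n (n + 2) j (by rw [abs_of_nonneg] <;> omega)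
    have z1 := chebEntry_eq_zero p q (n + 1) (n + 2) j (by rw [abs_of_nonneg] <;> omega)
    have z2 := chebEntry_eq_zero p q (n + 1) (n + 3) j (by rw [abs_of_nonneg] <;> omega)
    have m0 : (((n + 1 : ℕ) : ℤ) + 1) = n + 2 := by push_cast; ring
    rw [m0, chebEntry, z0, z1, show (n : ℤ) + 2 + 1 = n + 3 by ring, z2,
      show (n : ℤ) + 2 - 1 = n + 1 by ring, ih, blockProd_succ p (n + 1),
      show j + 1 + ((n + 1 : ℕ) : ℤ) = j + (n + 2) by push_cast; ring]
    ring

theorem chebEntry_diag_sub_one (p q : ℤ → ℝ) (n : ℕ) (j : ℤ) :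
    chebEntry p q (n + 1) n j = blockProd p n (j + 1) * blockSum q (n + 1) j := by
  induction n with
  | zero => simp [chebEntry, blockProd, blockSum]
  | succ n ih =>
    have z0 := chebEntry_eq_zero p q n (n + 1) j (by rw [abs_of_nonneg] <;> omega)
    have z1 := chebEntry_eq_zero p q (n + 1) (n + 2) j (by rw [abs_of_nonneg] <;> omega)
    have hb := chebEntry_diag p q n j
    push_cast
    rw [chebEntry, z0, show (n : ℤ) + 1 + 1 = n + 2 by ring, z1,
      show (n : ℤ) + 1 - 1 = n by ring, ih, hb, blockSum_succ q (n + 1), blockProd_succ p n,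
      show j + 1 + (n : ℤ) = j + (n + 1) by ring]
    push_cast
    ring

theorem chebEntry_diag_sub_two (p q : ℤ → ℝ) (n : ℕ) (j : ℤ) :
    chebEntry p q (n + 2) n j = blockProd p n (j + 1) *
      (blockSum (fun k => p k ^ 2 - 1) (n + 2) j
        + (blockSum q (n + 1) j ^ 2 + blockSum (fun k => q k ^ 2) (n + 1) j) / 2) := by
  induction n with
  | zero =>
    simp [chebEntry, blockProd, blockSum, Finset.sum_range_succ]
    ring
  | succ n ih =>
    have hb := chebEntry_diag p q n j
    have hb' := chebEntry_diag p q (n + 1) j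
    have hc := chebEntry_diag_sub_one p q (n + 1) j
    push_cast at hb' hc ⊢
    rw [chebEntry, show (n : ℤ) + 1 - 1 = n by ring, ih, hc, hb, hb',
      blockSum_succ _ (n + 2), blockSum_succ q (n + 1),
      blockSum_succ (fun k => q k ^ 2) (n + 1),
      blockProd_succ p (n + 1), blockProd_succ p n,
      show j + 1 + (n : ℤ) = j + (n + 1) by ring]
    push_cast
    rw [show j + 1 + ((n : ℤ) + 1) = j + (n + 2) by ring,
      show j + ((n : ℤ) + 1) + 1 = j + (n + 2) by ring]
    ring

theorem abs_blockSum_le {q : ℤ → ℝ} {D : ℝ} (hD : ∀ k, |q k| ≤ D) (n : ℕ) (s : ℤ) :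
    |blockSum q n s| ≤ n * D := by
  refine (Finset.abs_sum_le_sum_abs _ _).trans ?_
  simpa using Finset.sum_le_card_nsmul (Finset.range n) (fun i : ℕ => |q (s + i)|) D
    fun i _ => hD _

theorem le_blockSum {f : ℤ → ℝ} (hf : ∀ k, 0 ≤ f k) (n : ℕ) (s : ℤ) :
    f s ≤ blockSum f (n + 1) s := by
  rw [blockSum_succ']
  exact le_add_of_nonneg_left (Finset.sum_nonneg fun _ _ => hf _)

/-- A factor bounded below can be cancelled from a square-summable product. -/
theorem SqSummable.of_mul {f g : ℤ → ℝ} {ε : ℝ} (hε : 0 < ε) (hg : ∀ j, ε ≤ g j)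
    (h : SqSummable fun j => g j * f j) : SqSummable f :=
  h.of_le ε⁻¹ fun j => by
    rw [abs_mul, ← div_eq_inv_mul, le_div_iff₀ hε, mul_comm]
    exact mul_le_mul_of_nonneg_right ((hg j).trans (le_abs_self _)) (abs_nonneg _)

theorem exists_le_blockProd_of_succ {p : ℤ → ℝ} (hp : ∀ k, 0 < p k) {C : ℝ}
    (hC : ∀ k, |p k| ≤ C) {n : ℕ}
    (h : ∃ ε, 0 < ε ∧ ∀ j, ε ≤ blockProd p (n + 1) j) :
    ∃ ε, 0 < ε ∧ ∀ j, ε ≤ blockProd p n j := by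
  obtain ⟨ε, hε, h⟩ := h
  have hC0 : 0 < C := (hp 0).trans_le ((le_abs_self _).trans (hC 0))
  refine ⟨ε / C, by positivity, fun j => ?_⟩
  rw [div_le_iff₀ hC0]
  refine (h j).trans ?_
  rw [blockProd_succ]
  exact mul_le_mul_of_nonneg_left ((le_abs_self _).trans (hC _)) (blockProd_pos hp n j).le

theorem sq_sub_one_sub_log_ge {x : ℝ} (hx : 0 < x) :
    (x - 1) ^ 2 ≤ x ^ 2 - 1 - 2 * Real.log x := by
  nlinarith [Real.log_le_sub_one_of_pos hx]

theorem abs_sq_sub_one_le {p : ℤ → ℝ} {C : ℝ} (hC : ∀ k, |p k| ≤ C) (k : ℤ) :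
    |p k ^ 2 - 1| ≤ (C + 1) * |p k - 1| := by
  rw [show p k ^ 2 - 1 = (p k + 1) * (p k - 1) by ring, abs_mul]
  refine mul_le_mul_of_nonneg_right ((abs_add_le _ _).trans ?_) (abs_nonneg _)
  simpa using hC k

/-- The conclusion of the direct implication in terms of the three outermost diagonals. -/
theorem sqSummable_of_outer_diagonals {p q : ℤ → ℝ} (hp : ∀ k, 0 < p k) {C D : ℝ}
    (hC : ∀ k, |p k| ≤ C) (hD : ∀ k, |q k| ≤ D) (n : ℕ)
    (h0 : SqSummable fun j => blockProd p (n + 2) j - 1)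
    (h1 : SqSummable fun j => blockProd p (n + 1) (j + 1) * blockSum q (n + 2) j)
    (h2 : SqSummable fun j => blockProd p n (j + 1) *
      (blockSum (fun k => p k ^ 2 - 1) (n + 2) j
        + (blockSum q (n + 1) j ^ 2 + blockSum (fun k => q k ^ 2) (n + 1) j) / 2)) :
    SqSummable (blockSum (fun k => p k ^ 2 - 1) (n + 2)) ∧ SqSummable (blockSum q (n + 2)) ∧
      SqSummable (fun j => (p j - 1) ^ 2) ∧ SqSummable (fun j => q j ^ 2) := by
  have e2 := h0.exists_pos_le (blockProd_pos hp _)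
  have e1 := exists_le_blockProd_of_succ hp hC e2
  obtain ⟨ε₀, hε₀, e0⟩ := exists_le_blockProd_of_succ hp hC e1
  obtain ⟨ε₁, hε₁, e1⟩ := e1
  have hQ : SqSummable (blockSum q (n + 2)) := SqSummable.of_mul hε₁ (fun j => e1 (j + 1)) h1
  have hS := SqSummable.of_mul hε₀ (fun j => e0 (j + 1)) h2
  have hL := h0.log (blockProd_pos hp _)
  have hE : SqSummable fun j => blockSum q (n + 2) j * (blockSum q (n + 2) j
      - 2 * q (j + (n + 1))) := by
    refine (hQ.mul_bdd (g := fun j => blockSum q (n + 2) j - 2 * q (j + (n + 1)))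
      (C := (n + 2 : ℕ) * D + 2 * D) fun j => ?_).congr fun j => mul_comm _ _
    refine (abs_sub _ _).trans (add_le_add (abs_blockSum_le hD _ _) ?_)
    rw [abs_mul, abs_two]
    exact mul_le_mul_of_nonneg_left (hD _) zero_le_two
  have hH : ∀ j, blockSum q (n + 1) j ^ 2 + blockSum (fun k => q k ^ 2) (n + 1) j
      = blockSum q (n + 2) j * (blockSum q (n + 2) j - 2 * q (j + (n + 1)))
        + blockSum (fun k => q k ^ 2) (n + 2) j := fun j => by
    rw [blockSum_succ q (n + 1), blockSum_succ _ (n + 1)]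
    push_cast
    ring
  have hY : SqSummable fun j => blockSum (fun k => p k ^ 2 - 1 - 2 * Real.log (p k)) (n + 2) j
      + blockSum (fun k => q k ^ 2) (n + 2) j / 2 := by
    refine ((hS.sub (hL.const_mul 2)).sub (hE.const_mul (1 / 2))).congr fun j => ?_
    have hsplit : blockSum (fun k => p k ^ 2 - 1 - 2 * Real.log (p k)) (n + 2) j
        = blockSum (fun k => p k ^ 2 - 1) (n + 2) j
          - 2 * blockSum (fun k => Real.log (p k)) (n + 2) j := by
      simp only [blockSum, Finset.sum_sub_distrib, Finset.mul_sum]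
    rw [hsplit, hH, log_blockProd hp]
    ring
  have pos1 : ∀ k, 0 ≤ p k ^ 2 - 1 - 2 * Real.log (p k) := fun k =>
    (sq_nonneg _).trans (sq_sub_one_sub_log_ge (hp k))
  have hp2 : SqSummable fun j => (p j - 1) ^ 2 := hY.of_le 1 fun j => by
    rw [abs_of_nonneg (sq_nonneg _), one_mul]
    refine le_trans ?_ (le_abs_self _)
    have a1 := le_blockSum pos1 (n + 1) j
    have a2 := le_blockSum (f := fun k => q k ^ 2) (fun k => sq_nonneg _) (n + 1) j
    have a3 := sq_sub_one_sub_log_ge (hp j)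
    have a4 := sq_nonneg (q j)
    simp only [add_assoc, one_add_one_eq_two] at a1 a2
    linarith
  have hq2 : SqSummable fun j => q j ^ 2 := hY.of_le 2 fun j => by
    rw [abs_of_nonneg (sq_nonneg _)]
    refine le_trans ?_ (mul_le_mul_of_nonneg_left (le_abs_self _) zero_le_two)
    have a1 := le_blockSum pos1 (n + 1) j
    have a2 := le_blockSum (f := fun k => q k ^ 2) (fun k => sq_nonneg _) (n + 1) j
    have a3 := pos1 j
    simp only [add_assoc, one_add_one_eq_two] at a1 a2
    linarith
  refine ⟨?_, hQ, hp2, hq2⟩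
  have hqs : SqSummable (blockSum (fun k => q k ^ 2) (n + 2)) :=
    SqSummable.sum (n + 2) fun i => hq2.shift i
  refine (hS.sub ((hE.add hqs).const_mul (1 / 2))).congr fun j => ?_
  rw [hH]
  ring

/-- `T_n(J) - T_n(J₀)` is Hilbert–Schmidt iff the four sequences
`(Σ_{k=1}^n u_{j+k})_j, (Σ_{k=1}^n q_{j+k})_j, (u_j²)_j, (q_j²)_j` (with
`u_j = p_j² - 1`) are square-summable. -/
theorem stmt_12
    (p q : ℤ → ℝ) (hp : ∀ k, 0 < p k)
    (hpb : ∃ C, ∀ k, |p k| ≤ C) (hqb : ∃ C, ∀ k, |q k| ≤ C)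
    (J J₀ : HZ →L[ℝ] HZ)
    (hJ : ∀ k : ℤ, J (ez k) = p k • ez (k - 1) + q k • ez k + p (k + 1) • ez (k + 1))
    (hJ₀ : ∀ k : ℤ, J₀ (ez k) = ez (k - 1) + ez (k + 1))
    (n : ℕ) (hn : 1 ≤ n) :
    Summable (fun ij : ℤ × ℤ =>
        ⟪(aeval J (T n) - aeval J₀ (T n)) (ez ij.1), ez ij.2⟫ ^ 2)
      ↔ (Summable (fun j : ℤ => (∑ k ∈ Finset.Icc 1 (n : ℤ), (p (j + k) ^ 2 - 1)) ^ 2)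
        ∧ Summable (fun j : ℤ => (∑ k ∈ Finset.Icc 1 (n : ℤ), q (j + k)) ^ 2)
        ∧ Summable (fun j : ℤ => ((p j ^ 2 - 1) ^ 2) ^ 2)
        ∧ Summable (fun j : ℤ => (q j ^ 2) ^ 2)) := by
  obtain ⟨C, hC⟩ := hpb
  obtain ⟨D, hD⟩ := hqb
  rw [summable_inner_iff p q J J₀ hJ hJ₀, SqSummable.sum_Icc_iff (fun k => p k ^ 2 - 1),
    SqSummable.sum_Icc_iff q]
  have hu_of : SqSummable (fun j => (p j - 1) ^ 2) → SqSummable (fun j => (p j ^ 2 - 1) ^ 2) :=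
    fun h => h.of_le ((C + 1) ^ 2) fun j => by
      rw [abs_pow, abs_pow, ← mul_pow]
      exact pow_le_pow_left₀ (abs_nonneg _) (abs_sq_sub_one_le hC j) 2
  constructor
  · intro h
    suffices SqSummable (blockSum (fun k => p k ^ 2 - 1) n) ∧ SqSummable (blockSum q n) ∧
        SqSummable (fun j => (p j - 1) ^ 2) ∧ SqSummable (fun j => q j ^ 2) from
      ⟨this.1, this.2.1, hu_of this.2.2.1, this.2.2.2⟩
    obtain _ | _ | n := n
    · omega
    · have h1 : SqSummable fun j => p j - 1 :=
        ((h 1).shift (-1)).congr fun j => by simp [chebEntry, freeEntry]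
      have h0 : SqSummable q := (h 0).congr fun j => by simp [chebEntry, freeEntry]
      refine ⟨(h1.of_le (C + 1) (abs_sq_sub_one_le hC)).congr fun j => by simp [blockSum],
        h0.congr fun j => by simp [blockSum],
        h1.sq_of_bdd (C := C + 1) fun j => (abs_sub _ _).trans ?_, h0.sq_of_bdd hD⟩
      simpa using hC j
    · apply sqSummable_of_outer_diagonals hp hC hD n
      · refine ((h (n + 2)).shift (-1)).congr fun j => ?_
        have e := chebEntry_diag p q (n + 1) (j + -1)
        push_cast at e
        rw [show (n : ℤ) + 2 = n + 1 + 1 by ring, e, freeEntry, if_pos (by push_cast; ring),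
          if_neg (by push_cast; omega)]
        simp
      · refine (h (n + 1)).congr fun j => ?_
        have e := chebEntry_diag_sub_one p q (n + 1) j
        push_cast at e
        rw [e, freeEntry, if_neg (by push_cast; omega), if_neg (by push_cast; omega)]
        simp
      · refine (h n).congr fun j => ?_
        rw [chebEntry_diag_sub_two, freeEntry, if_neg (by push_cast; omega),
          if_neg (by push_cast; omega)]
        simp
  · rintro ⟨hU, hQ, hu, hq⟩ m
    have ha : SqSummable fun j => (p j - 1) ^ 2 :=
      SqSummable.of_le (g := fun j => (p j ^ 2 - 1) ^ 2) hu 1 fun j => by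
        rw [one_mul, abs_pow, abs_pow, show p j ^ 2 - 1 = (p j + 1) * (p j - 1) by ring, abs_mul]
        refine pow_le_pow_left₀ (abs_nonneg _) (le_mul_of_one_le_left (abs_nonneg _) ?_) 2
        exact le_trans (by linarith [hp j]) (le_abs_self _)
    have hA : SqSummable (blockSum (fun k => p k - 1) n) := by
      have hs : SqSummable (blockSum (fun k => (p k - 1) ^ 2) n) :=
        SqSummable.sum n fun i => ha.shift i
      refine ((hU.sub hs).const_mul (1 / 2)).congr fun j => ?_
      simp only [blockSum, ← Finset.sum_sub_distrib, Finset.mul_sum]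
      exact Finset.sum_congr rfl fun i _ => by ring
    refine ((sqSummable_chebEntry_sub p q hC hD ha hq n m).add
      (((hQ.linDiag m).add ((hA.linDiag (m - 1)).shift 1)).add (hA.linDiag (m + 1)))).congr
      fun j => ?_
    rw [linPart]
    ring

end
end
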